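/- arXiv:1806.10693 — 7 statements merged into one kernel-verified Lean document; each statement's English description precedes it below -/
import Mathlib

section
/- Let X be a finite dimensional Banach space (over ℝ or ℂ) with property (co). Then X has property CWO. -/
open Metric Topology

/-- The weak topology on a normed space `E` over `𝕜`. -/
def weakTop (𝕜 E : Type*) [NontriviallyNormedField 𝕜] [NormedAddCommGroup E]
    [NormedSpace 𝕜 E] : TopologicalSpace E :=
  TopologicalSpace.induced (fun (x : E) (f : E →L[𝕜] 𝕜) => f x) inferInstance

/-- `U` is a relatively weakly open subset of the closed unit ball of `E`. -/
def RelWeakOpen (𝕜 : Type*) {E : Type*} [NontriviallyNormedField 𝕜] [NormedAddCommGroup E]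
    [NormedSpace 𝕜 E] (U : Set E) : Prop :=
  U ⊆ closedBall 0 1 ∧ ∃ V : Set E, IsOpen[weakTop 𝕜 E] V ∧ U = V ∩ closedBall 0 1

/-- `x` is an interior point of `C` in the relative weak topology of the closed
unit ball of `E`. -/
def RelWeakInterior (𝕜 : Type*) {E : Type*} [NontriviallyNormedField 𝕜] [NormedAddCommGroup E]
    [NormedSpace 𝕜 E] (C : Set E) (x : E) : Prop :=
  ∃ V : Set E, IsOpen[weakTop 𝕜 E] V ∧ x ∈ V ∧ V ∩ closedBall 0 1 ⊆ C

/-- The convex combination `∑ j, lam j • U j` of the sets `U j` with coefficients `lam j`. -/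
def ConvComb (𝕜 : Type*) {E : Type*} [RCLike 𝕜] [NormedAddCommGroup E] [NormedSpace 𝕜 E]
    {n : ℕ} (lam : Fin n → ℝ) (U : Fin n → Set E) : Set E :=
  {x | ∃ u : Fin n → E, (∀ j, u j ∈ U j) ∧ x = ∑ j, ((lam j : ℝ) : 𝕜) • u j}

/-- `X` has property CWO. -/
def PropCWO (𝕜 E : Type*) [RCLike 𝕜] [NormedAddCommGroup E] [NormedSpace 𝕜 E] : Prop :=
  ∀ (n : ℕ) (U : Fin n → Set E) (lam : Fin n → ℝ),
    (∀ j, RelWeakOpen 𝕜 (U j)) → (∀ j, 0 < lam j) → (∑ j, lam j) = 1 →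
    ∃ V : Set E, IsOpen[weakTop 𝕜 E] V ∧ ConvComb 𝕜 lam U = V ∩ closedBall 0 1

/-- `X` has property CWO-S. -/
def PropCWOS (𝕜 E : Type*) [RCLike 𝕜] [NormedAddCommGroup E] [NormedSpace 𝕜 E] : Prop :=
  ∀ (n : ℕ) (U : Fin n → Set E) (lam : Fin n → ℝ),
    (∀ j, RelWeakOpen 𝕜 (U j)) → (∀ j, 0 < lam j) → (∑ j, lam j) = 1 →
    ∀ x ∈ ConvComb 𝕜 lam U, ‖x‖ = 1 → RelWeakInterior 𝕜 (ConvComb 𝕜 lam U) x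

/-- `X` has property CWO-B. -/
def PropCWOB (𝕜 E : Type*) [RCLike 𝕜] [NormedAddCommGroup E] [NormedSpace 𝕜 E] : Prop :=
  ∀ (n : ℕ) (U : Fin n → Set E) (lam : Fin n → ℝ),
    (∀ j, RelWeakOpen 𝕜 (U j)) → (∀ j, 0 < lam j) → (∑ j, lam j) = 1 →
    ∀ x ∈ ConvComb 𝕜 lam U, ‖x‖ < 1 → RelWeakInterior 𝕜 (ConvComb 𝕜 lam U) x

/-- A point `x` of the closed unit ball has property (co n). -/
def HasCoN (𝕜 : Type*) {E : Type*} [RCLike 𝕜] [NormedAddCommGroup E] [NormedSpace 𝕜 E]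
    (n : ℕ) (x : E) : Prop :=
  ∀ (xs : Fin n → E) (lam : Fin n → ℝ),
    (∀ j, ‖xs j‖ ≤ 1) → (∀ j, 0 < lam j) → (∑ j, lam j) = 1 →
    x = (∑ j, ((lam j : ℝ) : 𝕜) • xs j) →
    ∀ ε : ℝ, 0 < ε → ∃ δ : ℝ, 0 < δ ∧
      ∃ v : Fin n → ((ball x δ ∩ closedBall 0 1 : Set E) → E),
        (∀ j, Continuous (v j)) ∧
        ∀ u : (ball x δ ∩ closedBall 0 1 : Set E),
          (∀ j, ‖v j u‖ ≤ 1) ∧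
          (u : E) = (∑ j, ((lam j : ℝ) : 𝕜) • v j u) ∧
          ∀ j, ‖v j u - xs j‖ < ε

/-- A point `x` of the closed unit ball has property (co). -/
def HasCoPt (𝕜 : Type*) {E : Type*} [RCLike 𝕜] [NormedAddCommGroup E] [NormedSpace 𝕜 E]
    (x : E) : Prop :=
  ∀ n : ℕ, 2 ≤ n → HasCoN 𝕜 n x

/-- The space has property (co). -/
def PropCo (𝕜 E : Type*) [RCLike 𝕜] [NormedAddCommGroup E] [NormedSpace 𝕜 E] : Prop :=
  ∀ x : E, ‖x‖ ≤ 1 → HasCoPt 𝕜 x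

/-- `x` is an extreme point of the closed unit ball of `E`
(with respect to the real convex structure). -/
def IsExtremePt (𝕜 : Type*) {E : Type*} [RCLike 𝕜] [NormedAddCommGroup E] [NormedSpace 𝕜 E]
    (x : E) : Prop :=
  ‖x‖ ≤ 1 ∧ ∀ y z : E, ‖y‖ ≤ 1 → ‖z‖ ≤ 1 → ∀ t : ℝ, 0 < t → t < 1 →
    x = ((t : ℝ) : 𝕜) • y + (((1 - t : ℝ) : ℝ) : 𝕜) • z → y = x ∧ z = x

/-- A topological space is scattered if every non-empty subset `A` has a point
isolated in `A`. -/
def Scattered (K : Type*) [TopologicalSpace K] : Prop :=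
  ∀ A : Set K, A.Nonempty → ∃ a ∈ A, ∃ U : Set K, IsOpen U ∧ U ∩ A = {a}


theorem weakTop_eq_norm (𝕜 E : Type*) [RCLike 𝕜] [NormedAddCommGroup E] [NormedSpace 𝕜 E]
    [FiniteDimensional 𝕜 E] :
    weakTop 𝕜 E = (inferInstance : TopologicalSpace E) := by
  apply le_antisymm
  · rw [← continuous_id_iff_le]
    let b := Module.finBasis 𝕜 E
    have h : (id : E → E) = fun x => ∑ i, (LinearMap.toContinuousLinearMap (b.coord i)) x • b i := by
      funext x
      exact (b.sum_repr x).symm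
    rw [h]
    have hc : ∀ f : E →L[𝕜] 𝕜, @Continuous E 𝕜 (weakTop 𝕜 E) _ (fun x => f x) := by
      intro f
      have h1 : @Continuous E ((E →L[𝕜] 𝕜) → 𝕜) (weakTop 𝕜 E) _ (fun x f => f x) :=
        continuous_induced_dom
      have h2 : Continuous (fun g : (E →L[𝕜] 𝕜) → 𝕜 => g f) := continuous_apply f
      exact @Continuous.comp E ((E →L[𝕜] 𝕜) → 𝕜) 𝕜 (weakTop 𝕜 E) _ _ (fun x f => f x) (fun g => g f) h2 h1
    refine @continuous_finsetSum _ E E (weakTop 𝕜 E) _ _ _ _ _ ?_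
    intro i _
    have h2 : Continuous (fun c : 𝕜 => c • b i) := by fun_prop
    exact @Continuous.comp E 𝕜 E (weakTop 𝕜 E) _ _ _ _ h2 (hc _)
  · unfold weakTop
    rw [← continuous_iff_le_induced]
    exact continuous_pi fun f => f.continuous

/-- A finite dimensional Banach space with property (co) has property CWO. -/
theorem stmt0 {𝕜 E : Type*} [RCLike 𝕜] [NormedAddCommGroup E] [NormedSpace 𝕜 E]
    [FiniteDimensional 𝕜 E] (hco : PropCo 𝕜 E) :
    PropCWO 𝕜 E := by
  intro n U lam hU hlam hsum
  rw [weakTop_eq_norm]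
  have hUn : ∀ j, ∃ V : Set E, IsOpen V ∧ U j = V ∩ closedBall 0 1 := by
    intro j
    obtain ⟨_, V, hV, h⟩ := hU j
    rw [weakTop_eq_norm] at hV
    exact ⟨V, hV, h⟩
  have hball : ConvComb 𝕜 lam U ⊆ closedBall 0 1 := by
    rintro x ⟨u, hu, rfl⟩
    rw [mem_closedBall_zero_iff, ← hsum]
    refine (norm_sum_le _ _).trans (Finset.sum_le_sum fun j _ => ?_)
    have h1 : ‖u j‖ ≤ 1 := by simpa using (hU j).1 (hu j)
    rw [norm_smul, RCLike.norm_ofReal, abs_of_pos (hlam j)]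
    exact mul_le_of_le_one_right (hlam j).le h1
  have key : ∀ x ∈ ConvComb 𝕜 lam U, ∃ δ > 0, ball x δ ∩ closedBall 0 1 ⊆ ConvComb 𝕜 lam U := by
    intro x hx
    have hxb : ‖x‖ ≤ 1 := by simpa using hball hx
    obtain ⟨u, hu, hxu⟩ := hx
    have hε : ∀ j, ∃ ε > 0, ball (u j) ε ∩ closedBall 0 1 ⊆ U j := by
      intro j
      obtain ⟨V, hV, h⟩ := hUn j
      have hj := hu j
      rw [h] at hj
      obtain ⟨ε, h0, hs⟩ := Metric.isOpen_iff.1 hV _ hj.1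
      refine ⟨ε, h0, ?_⟩
      rw [h]
      exact Set.inter_subset_inter_left _ hs
    have hun : ∀ j, ‖u j‖ ≤ 1 := fun j => by simpa using (hU j).1 (hu j)
    rcases Nat.lt_or_ge n 2 with hn | hn
    · interval_cases n
      · simp at hsum
      · obtain ⟨ε, h0, hs⟩ := hε 0
        have hl : lam 0 = 1 := by simpa using hsum
        have hx0 : x = u 0 := by simpa [hl] using hxu
        refine ⟨ε, h0, fun y hy => ⟨fun _ => y, fun j => ?_, by simp [hl]⟩⟩
        rw [hx0] at hy
        rw [Subsingleton.elim j 0]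
        exact hs hy
    · choose ε h0 hs using hε
      obtain ⟨e, he, hle⟩ : ∃ e > 0, ∀ j, e ≤ ε j := by
        haveI : Nonempty (Fin n) := ⟨⟨0, by omega⟩⟩
        obtain ⟨j, hj⟩ := Finite.exists_min ε
        exact ⟨ε j, h0 j, hj⟩
      obtain ⟨δ, hδ, v, _, hv⟩ := hco x hxb n hn u lam hun hlam hsum hxu e he
      refine ⟨δ, hδ, fun y hy => ?_⟩
      obtain ⟨hv1, hv2, hv3⟩ := hv ⟨y, hy⟩
      refine ⟨fun j => v j ⟨y, hy⟩, fun j => hs j ⟨?_, ?_⟩, hv2⟩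
      · rw [mem_ball_iff_norm]
        exact (hv3 j).trans_le (hle j)
      · simpa using hv1 j
  choose! δ hδ hsub using key
  refine ⟨⋃ x ∈ ConvComb 𝕜 lam U, ball x (δ x), isOpen_biUnion fun _ _ => isOpen_ball, ?_⟩
  apply Set.Subset.antisymm
  · intro x hx
    exact ⟨Set.mem_biUnion hx (mem_ball_self (hδ x hx)), hball hx⟩
  · rintro y ⟨hy, hyb⟩
    obtain ⟨x, hx, hxy⟩ := Set.mem_iUnion₂.1 hy
    exact hsub x hx ⟨hxy, hyb⟩
end

section
/- Let X be a Banach space (over ℝ or ℂ) and let x ∈ B_X. If x is an extreme point of B_X or ‖x‖ < 1, then x has property (co). -/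
open Metric Topology

/-- If `x ∈ B_X` is an extreme point of `B_X` or `‖x‖ < 1`,
then `x` has property (co). -/
theorem stmt1 {𝕜 E : Type*} [RCLike 𝕜] [NormedAddCommGroup E] [NormedSpace 𝕜 E]
    [CompleteSpace E] (x : E) (hx : ‖x‖ ≤ 1)
    (h : IsExtremePt 𝕜 x ∨ ‖x‖ < 1) :
    HasCoPt 𝕜 x := by
  intro n hn xs lam hxs hlam hsum hxe ε hε
  have hsumK : ∑ j, ((lam j : ℝ) : 𝕜) = 1 := by
    rw [← RCLike.ofReal_sum, hsum, RCLike.ofReal_one]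
  rcases h with h | h
  · have key : ∀ j, xs j = x := by
      intro j
      have hnt : ∃ i, i ≠ j := by
        haveI : Nontrivial (Fin n) := Fin.nontrivial_iff_two_le.2 hn
        exact exists_ne j
      obtain ⟨i, hij⟩ := hnt
      have hsplit : lam j + ∑ i ∈ Finset.univ.erase j, lam i = 1 := by
        rw [Finset.add_sum_erase _ _ (Finset.mem_univ j), hsum]
      have hpos : 0 < ∑ i ∈ Finset.univ.erase j, lam i :=
        Finset.sum_pos (fun i _ => hlam i) ⟨i, by simp [hij]⟩
      have hlt : 0 < 1 - lam j := by linarith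
      have hne : (((1 - lam j : ℝ) : ℝ) : 𝕜) ≠ 0 := by
        exact_mod_cast hlt.ne'
      have hbound : ‖∑ i ∈ Finset.univ.erase j, ((lam i : ℝ) : 𝕜) • xs i‖ ≤ 1 - lam j := by
        calc ‖∑ i ∈ Finset.univ.erase j, ((lam i : ℝ) : 𝕜) • xs i‖
            ≤ ∑ i ∈ Finset.univ.erase j, lam i := by
              refine norm_sum_le_of_le _ (fun i _ => ?_)
              rw [norm_smul, RCLike.norm_ofReal, abs_of_pos (hlam i)]
              exact mul_le_of_le_one_right (hlam i).le (hxs i)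
          _ = 1 - lam j := by linarith
      refine (h.2 (xs j) ((((1 - lam j : ℝ) : ℝ) : 𝕜)⁻¹ •
        ∑ i ∈ Finset.univ.erase j, ((lam i : ℝ) : 𝕜) • xs i) (hxs j) ?_ (lam j)
        (hlam j) (by linarith) ?_).1
      · rw [norm_smul, norm_inv, RCLike.norm_ofReal, abs_of_pos hlt]
        exact inv_mul_le_one_of_le₀ hbound hlt.le
      · rw [smul_inv_smul₀ hne, hxe,
          Finset.add_sum_erase _ (fun i => ((lam i : ℝ) : 𝕜) • xs i) (Finset.mem_univ j)]
    refine ⟨ε, hε, fun _ u => u, fun _ => continuous_subtype_val, fun u => ⟨fun _ => ?_, ?_, ?_⟩⟩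
    · simpa using u.2.2
    · rw [← Finset.sum_smul, hsumK, one_smul]
    · intro j
      rw [key j, ← dist_eq_norm]
      exact u.2.1
  · obtain ⟨s, hs0, hs1, hsε⟩ : ∃ s : ℝ, 0 < s ∧ s ≤ 1 ∧ s ≤ ε / 4 :=
      ⟨min 1 (ε / 4), lt_min one_pos (by linarith), min_le_left _ _, min_le_right _ _⟩
    have h1x : 0 < 1 - ‖x‖ := by linarith
    refine ⟨s * (1 - ‖x‖), mul_pos hs0 h1x,
      fun j u => ((1 - s : ℝ) : 𝕜) • xs j + ((s : ℝ) : 𝕜) • x + ((u : E) - x),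
      fun j => by fun_prop, fun u => ?_⟩
    have hu : ‖(u : E) - x‖ < s * (1 - ‖x‖) := by
      rw [← dist_eq_norm]; exact u.2.1
    have hsx : ‖((s : ℝ) : 𝕜) • x‖ = s * ‖x‖ := by
      rw [norm_smul, RCLike.norm_ofReal, abs_of_pos hs0]
    refine ⟨fun j => ?_, ?_, fun j => ?_⟩
    · have h1 : ‖((1 - s : ℝ) : 𝕜) • xs j‖ ≤ 1 - s := by
        rw [norm_smul, RCLike.norm_ofReal, abs_of_nonneg (by linarith)]
        exact mul_le_of_le_one_right (by linarith) (hxs j)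
      refine (norm_add₃_le).trans ?_
      rw [hsx]
      nlinarith
    · simp only [smul_add, Finset.sum_add_distrib]
      rw [← Finset.sum_smul, ← Finset.sum_smul, hsumK]
      simp_rw [smul_comm _ ((1 - s : ℝ) : 𝕜)]
      rw [← Finset.smul_sum, ← hxe, one_smul, one_smul, ← add_smul, ← RCLike.ofReal_add]
      simp
    · have e : ((1 - s : ℝ) : 𝕜) • xs j + ((s : ℝ) : 𝕜) • x + ((u : E) - x) - xs j
          = ((s : ℝ) : 𝕜) • (x - xs j) + ((u : E) - x) := by
        rw [RCLike.ofReal_sub, RCLike.ofReal_one]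
        module
      rw [e]
      have h2 : ‖((s : ℝ) : 𝕜) • (x - xs j)‖ ≤ s * 2 := by
        rw [norm_smul, RCLike.norm_ofReal, abs_of_pos hs0]
        refine mul_le_mul_of_nonneg_left ((norm_sub_le _ _).trans ?_) hs0.le
        linarith [hxs j]
      have := norm_add_le (((s : ℝ) : 𝕜) • (x - xs j)) ((u : E) - x)
      nlinarith [norm_nonneg x]
end

section
/- Every strictly convex Banach space (over ℝ or ℂ) has property (co). -/
open Metric Topology

/-- Every strictly convex Banach space has property (co). -/
theorem stmt2 {𝕜 E : Type*} [RCLike 𝕜] [NormedAddCommGroup E] [NormedSpace 𝕜 E]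
    [CompleteSpace E] (hsc : ∀ x : E, ‖x‖ = 1 → IsExtremePt 𝕜 x) :
    PropCo 𝕜 E := by
  intro x hx n hn xs lam hxs hlam hsum hxeq ε hε
  have hsum' : (∑ j, ((lam j : ℝ) : 𝕜)) = 1 := by
    rw [← RCLike.ofReal_sum, hsum, RCLike.ofReal_one]
  by_cases hall : ∀ a b, xs a = xs b
  · have hx' : ∀ j, xs j = x := by
      intro j
      rw [hxeq, Finset.sum_congr rfl (fun i _ => by rw [hall i j]), ← Finset.sum_smul, hsum',
        one_smul]
    refine ⟨ε, hε, fun _ u => u, fun _ => continuous_subtype_val, fun u => ⟨fun _ => ?_, ?_, ?_⟩⟩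
    · simpa using u.2.2
    · rw [← Finset.sum_smul, hsum', one_smul]
    · intro j
      rw [hx' j]
      simpa [dist_eq_norm] using u.2.1
  push Not at hall
  obtain ⟨a, b, hab⟩ := hall
  have hne : a ≠ b := fun h => hab (by rw [h])
  have hl1 : ∀ j, lam j ≤ 1 := fun j => by
    rw [← hsum]
    exact Finset.single_le_sum (fun i _ => (hlam i).le) (Finset.mem_univ j)
  -- strictly convex combinations
  have conv : ∀ (y z : E) (s : ℝ), ‖y‖ ≤ 1 → ‖z‖ ≤ 1 → y ≠ z → 0 < s → s < 1 →
      ‖y + (s : 𝕜) • (z - y)‖ < 1 := by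
    intro y z s hy hz hyz h0 h1
    have e : y + (s : 𝕜) • (z - y) = (s : 𝕜) • z + ((1 - s : ℝ) : 𝕜) • y := by
      push_cast
      module
    have hle : ‖y + (s : 𝕜) • (z - y)‖ ≤ 1 := by
      rw [e]
      refine (norm_add_le _ _).trans ?_
      rw [norm_smul, norm_smul, RCLike.norm_ofReal, RCLike.norm_ofReal, abs_of_pos h0,
        abs_of_pos (sub_pos.2 h1)]
      nlinarith
    refine lt_of_le_of_ne hle fun h => ?_
    obtain ⟨h3, h4⟩ := (hsc _ h).2 z y hz hy s h0 h1 e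
    exact hyz (h4.trans h3.symm)
  have diff : ∀ (y z : E) (s : ℝ), ‖y‖ ≤ 1 → ‖z‖ ≤ 1 → 0 < s → s ≤ ε / 8 →
      ‖(s : 𝕜) • (z - y)‖ ≤ ε / 4 := by
    intro y z s hy hz h0 h1
    rw [norm_smul, RCLike.norm_ofReal, abs_of_pos h0]
    have := norm_sub_le z y
    nlinarith [norm_nonneg (z - y)]
  obtain ⟨m, hm0, hm1, hm2⟩ : ∃ m : ℝ, 0 < m ∧ m < 1 ∧ m ≤ ε / 8 :=
    ⟨min (1/2) (ε/8), by positivity, (min_le_left _ _).trans_lt (by norm_num), min_le_right _ _⟩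
  have hs : ∀ j, 0 < lam j * m ∧ lam j * m < 1 ∧ lam j * m ≤ ε / 8 := fun j => by
    have h1 := hlam j
    have h2 := hl1 j
    have : lam j * m ≤ m := by nlinarith
    exact ⟨by positivity, by linarith, by linarith⟩
  have ha := conv _ _ _ (hxs a) (hxs b) hab (hs b).1 (hs b).2.1
  have hb := conv _ _ _ (hxs b) (hxs a) hab.symm (hs a).1 (hs a).2.1
  have da := diff _ _ _ (hxs a) (hxs b) (hs b).1 (hs b).2.2
  have db := diff _ _ _ (hxs b) (hxs a) (hs a).1 (hs a).2.2
  set p : E := ((lam b * m : ℝ) : 𝕜) • (xs b - xs a) with hp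
  set q : E := ((lam a * m : ℝ) : 𝕜) • (xs a - xs b) with hq
  have hla := hlam a
  have hla0 : (lam a : 𝕜) ≠ 0 := by exact_mod_cast hla.ne'
  have hmin : 0 < min (1 - ‖xs a + p‖) (ε / 2) := lt_min (by linarith) (by linarith)
  refine ⟨lam a * min (1 - ‖xs a + p‖) (ε / 2), by positivity,
    fun j u => xs j + (if j = a then p + (lam a : 𝕜)⁻¹ • ((u : E) - x) else 0)
      + (if j = b then q else 0), ?_, ?_⟩
  · intro j
    by_cases h1 : j = a <;> simp only [h1, if_true, if_false] <;> fun_prop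
  · intro u
    have hu : ‖(lam a : 𝕜)⁻¹ • ((u : E) - x)‖ < min (1 - ‖xs a + p‖) (ε / 2) := by
      have h := u.2.1
      rw [mem_ball, dist_eq_norm] at h
      rw [norm_smul, norm_inv, RCLike.norm_ofReal, abs_of_pos hla, inv_mul_lt_iff₀ hla]
      exact h
    have hu1 := hu.trans_le (min_le_left _ _)
    have hu2 := hu.trans_le (min_le_right _ _)
    refine ⟨?_, ?_, ?_⟩
    · intro j
      by_cases h1 : j = a
      · subst h1
        simp only [if_true, if_neg hne, add_zero, ← add_assoc]
        have := norm_add_le (xs j + p) ((lam j : 𝕜)⁻¹ • ((u : E) - x))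
        linarith
      · by_cases h2 : j = b
        · subst h2
          simpa [h1] using hb.le
        · simpa [h1, h2] using hxs j
    · simp only [smul_add, Finset.sum_add_distrib, smul_ite, smul_zero, Finset.sum_ite_eq',
        Finset.mem_univ, if_true]
      have hpq : (lam a : 𝕜) • p + (lam b : 𝕜) • q = 0 := by
        rw [hp, hq]
        push_cast
        module
      rw [← hxeq, smul_inv_smul₀ hla0, eq_neg_of_add_eq_zero_left hpq]
      abel
    · intro j
      by_cases h1 : j = a
      · subst h1
        simp only [if_true, if_neg hne, add_zero, add_sub_cancel_left]
        have := norm_add_le p ((lam j : 𝕜)⁻¹ • ((u : E) - x))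
        linarith
      · by_cases h2 : j = b
        · subst h2
          simp only [h1, if_true, if_false, add_zero, add_sub_cancel_left]
          linarith
        · simpa [h1, h2] using hε
end

section
/- Let K be a scattered locally compact Hausdorff space and let X be a finite dimensional Banach space. Suppose x ∈ B_{C_0(K,X)} is such that, for every t ∈ K, the point x(t) ∈ B_X has property (co). Then, whenever x belongs to a finite convex combination Σ_{j=1}^n λ_j U_j (where U_1,…,U_n are relatively weakly open subsets of B_{C_0(K,X)} and λ_1,…,λ_n > 0 with Σλ_j = 1), the element x is an interior point of this convex combination in the relative weak topology of B_{C_0(K,X)}. -/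
open Metric Topology

section Aux

open ZeroAtInfty

variable {𝕜 K X : Type*} [RCLike 𝕜] [TopologicalSpace K] [NormedAddCommGroup X]

lemma c0_le (g : C₀(K, X)) (t : K) : ‖g t‖ ≤ ‖g‖ := g.toBCF.norm_coe_le_norm t

lemma c0_norm_le {g : C₀(K, X)} {C : ℝ} (hC : 0 ≤ C) (h : ∀ t, ‖g t‖ ≤ C) : ‖g‖ ≤ C :=
  (BoundedContinuousFunction.norm_le (f := g.toBCF) hC).2 h

lemma exists_c0 (h : K → X) (hc : Continuous h) (hs : IsCompact (tsupport h)) :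
    ∃ g : C₀(K, X), ∀ s, g s = h s :=
  ⟨⟨⟨h, hc⟩, HasCompactSupport.is_zero_at_infty (f := h) hs⟩, fun _ => rfl⟩

/-- `g` is compactly supported inside `O`. -/
def CSupp (g : C₀(K, X)) (O : Set K) : Prop := IsCompact (tsupport g) ∧ tsupport g ⊆ O

variable [NormedSpace 𝕜 X]

lemma exists_phi_mul (φ : C(K, ℝ)) (hφ : ∀ s, φ s ∈ Set.Icc (0 : ℝ) 1)
    (g : C₀(K, X)) (hg : IsCompact (tsupport g)) :
    ∃ h : C₀(K, X), (∀ s, h s = ((φ s : ℝ) : 𝕜) • g s) ∧ ‖h‖ ≤ ‖g‖ ∧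
      IsCompact (tsupport h) ∧ tsupport h ⊆ tsupport φ := by
  have hsub : tsupport (fun s => ((φ s : ℝ) : 𝕜) • g s) ⊆ tsupport g :=
    closure_mono (Function.support_smul_subset_right _ _)
  have hcpt : IsCompact (tsupport (fun s => ((φ s : ℝ) : 𝕜) • g s)) :=
    hg.of_isClosed_subset (isClosed_tsupport _) hsub
  have hcont : Continuous (fun s => ((φ s : ℝ) : 𝕜) • g s) :=
    (RCLike.continuous_ofReal.comp φ.continuous).smul (map_continuous g)
  obtain ⟨h, hh⟩ := exists_c0 _ hcont hcpt
  have hfun : (h : K → X) = fun s => ((φ s : ℝ) : 𝕜) • g s := funext hh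
  refine ⟨h, hh, ?_, ?_, ?_⟩
  · refine c0_norm_le (norm_nonneg _) fun t => ?_
    rw [hh, norm_smul, RCLike.norm_ofReal, abs_of_nonneg (hφ t).1]
    calc φ t * ‖g t‖ ≤ 1 * ‖g t‖ := by gcongr; exact (hφ t).2
      _ ≤ ‖g‖ := by rw [one_mul]; exact c0_le g t
  · rw [hfun]; exact hcpt
  · rw [hfun]
    refine closure_mono ?_
    intro s hs
    simp only [Function.mem_support, ne_eq, smul_eq_zero, not_or, RCLike.ofReal_eq_zero] at hs
    exact hs.1

/-- Up to finitely many points, the functional `f` has mass at most `ε` on `O`. -/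
def QB (f : C₀(K, X) →L[𝕜] 𝕜) (O : Set K) (ε : ℝ) : Prop :=
  ∃ F : Finset K, ∀ g : C₀(K, X), CSupp g (O \ F) → ‖f g‖ ≤ ε * ‖g‖

lemma QB.mono {f : C₀(K, X) →L[𝕜] 𝕜} {O O' : Set K} {ε : ℝ} (h : QB f O ε) (hO : O' ⊆ O) :
    QB f O' ε := by
  obtain ⟨F, hF⟩ := h
  exact ⟨F, fun g hg => hF g ⟨hg.1, hg.2.trans (Set.sdiff_subset_sdiff_left hO)⟩⟩

lemma QB.union [T2Space K] [LocallyCompactSpace K] {f : C₀(K, X) →L[𝕜] 𝕜} {O₁ O₂ : Set K}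
    {ε₁ ε₂ : ℝ} (h₁ : QB f O₁ ε₁) (h₂ : QB f O₂ ε₂) (ho₁ : IsOpen O₁) (ho₂ : IsOpen O₂)
    (he₁ : 0 ≤ ε₁) (he₂ : 0 ≤ ε₂) :
    QB f (O₁ ∪ O₂) (ε₁ + ε₂) := by
  classical
  obtain ⟨F₁, hF₁⟩ := h₁
  obtain ⟨F₂, hF₂⟩ := h₂
  refine ⟨F₁ ∪ F₂, fun g hg => ?_⟩
  let s : Fin 2 → Set K := ![O₁ \ F₁, O₂ \ F₂]
  have hs : ∀ i, IsOpen (s i) := by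
    intro i
    fin_cases i
    · exact ho₁.sdiff F₁.finite_toSet.isClosed
    · exact ho₂.sdiff F₂.finite_toSet.isClosed
  have hst : tsupport g ⊆ ⋃ i, s i := by
    intro t ht
    have := hg.2 ht
    simp only [Finset.coe_union, Set.mem_sdiff, Set.mem_union, not_or] at this
    rcases this.1 with h | h
    · exact Set.mem_iUnion.2 ⟨0, h, this.2.1⟩
    · exact Set.mem_iUnion.2 ⟨1, h, this.2.2⟩
  obtain ⟨φ, hφs, hφ1, hφI, -⟩ := exists_continuous_sum_one_of_isOpen_isCompact hs hg.1 hst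
  obtain ⟨g₁, e₁, n₁, c₁, t₁⟩ := exists_phi_mul (𝕜 := 𝕜) (φ 0) (hφI 0) g hg.1
  obtain ⟨g₂, e₂, n₂, c₂, t₂⟩ := exists_phi_mul (𝕜 := 𝕜) (φ 1) (hφI 1) g hg.1
  have hsum : g = g₁ + g₂ := by
    ext t
    rw [ZeroAtInftyContinuousMap.add_apply, e₁, e₂, ← add_smul]
    by_cases ht : t ∈ tsupport g
    · have := hφ1 ht
      simp only [Fin.sum_univ_two, ContinuousMap.coe_add, Pi.add_apply, Pi.one_apply] at this
      rw [← RCLike.ofReal_add, this, RCLike.ofReal_one, one_smul]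
    · rw [image_eq_zero_of_notMem_tsupport ht, smul_zero]
  have b₁ := hF₁ g₁ ⟨c₁, t₁.trans (hφs 0)⟩
  have b₂ := hF₂ g₂ ⟨c₂, t₂.trans (hφs 1)⟩
  calc ‖f g‖ = ‖f g₁ + f g₂‖ := by rw [hsum, map_add]
    _ ≤ ‖f g₁‖ + ‖f g₂‖ := norm_add_le _ _
    _ ≤ ε₁ * ‖g₁‖ + ε₂ * ‖g₂‖ := add_le_add b₁ b₂
    _ ≤ ε₁ * ‖g‖ + ε₂ * ‖g‖ := by gcongr
    _ = _ := by ring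

lemma csupp_smul {g : C₀(K, X)} {O : Set K} (hg : CSupp g O) (c : 𝕜) : CSupp (c • g) O := by
  have : tsupport (c • g : C₀(K, X)) ⊆ tsupport g := by
    refine closure_mono fun s hs => ?_
    simp only [Function.mem_support, ZeroAtInftyContinuousMap.smul_apply] at hs ⊢
    intro h
    exact hs (by rw [h, smul_zero])
  exact ⟨hg.1.of_isClosed_subset (isClosed_tsupport _) this, this.trans hg.2⟩

lemma exists_unimod (z : 𝕜) : ∃ c : 𝕜, ‖c‖ = 1 ∧ c * z = (‖z‖ : 𝕜) := RCLike.exists_norm_eq_mul_self z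
  |>.imp fun c h => ⟨h.1, h.2.symm⟩

lemma QB.regular [T2Space K] (f : C₀(K, X) →L[𝕜] 𝕜) (O : Set K) {ε : ℝ} (hε : 0 < ε) :
    ∃ C : Set K, IsCompact C ∧ C ⊆ O ∧ QB f (O \ C) ε := by
  let S : Set ℝ := {r | ∃ g : C₀(K, X), CSupp g O ∧ ‖g‖ ≤ 1 ∧ RCLike.re (f g) = r}
  have hbd : BddAbove S := by
    refine ⟨‖f‖, ?_⟩
    rintro r ⟨g, -, hg, rfl⟩
    calc RCLike.re (f g) ≤ ‖f g‖ := RCLike.re_le_norm _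
      _ ≤ ‖f‖ * ‖g‖ := f.le_opNorm g
      _ ≤ ‖f‖ * 1 := by gcongr
      _ = _ := mul_one _
  have hz : tsupport ((0 : C₀(K, X)) : K → X) = ∅ := by
    rw [tsupport_eq_empty_iff]; rfl
  have hne : S.Nonempty :=
    ⟨0, 0, ⟨by rw [hz]; exact isCompact_empty, by rw [hz]; exact Set.empty_subset _⟩, by simp,
      by simp⟩
  obtain ⟨_, ⟨g, hg, hg1, rfl⟩, hlt⟩ := exists_lt_of_lt_csSup hne (sub_lt_self (sSup S) hε)
  have key : ∀ h : C₀(K, X), CSupp h (O \ tsupport g) → ‖h‖ ≤ 1 → RCLike.re (f h) ≤ ε := by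
    intro h hh h1
    have hts : tsupport (g + h : C₀(K, X)) ⊆ tsupport g ∪ tsupport h := by
      rw [tsupport, tsupport, tsupport, ← closure_union]
      exact closure_mono (Function.support_add _ _)
    have hmem : RCLike.re (f (g + h)) ∈ S := by
      refine ⟨g + h, ⟨(hg.1.union hh.1).of_isClosed_subset (isClosed_tsupport _) hts,
        hts.trans (Set.union_subset hg.2 (hh.2.trans Set.sdiff_subset))⟩, ?_, rfl⟩
      refine c0_norm_le zero_le_one fun t => ?_
      rw [ZeroAtInftyContinuousMap.add_apply]
      by_cases ht : t ∈ tsupport g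
      · have : t ∉ tsupport h := fun h' => (hh.2 h').2 ht
        rw [image_eq_zero_of_notMem_tsupport this, add_zero]
        exact (c0_le g t).trans hg1
      · rw [image_eq_zero_of_notMem_tsupport ht, zero_add]
        exact (c0_le h t).trans h1
    have := le_csSup hbd hmem
    rw [map_add, map_add] at this
    linarith
  refine ⟨tsupport g, hg.1, hg.2, ∅, fun h hh => ?_⟩
  rw [Finset.coe_empty, Set.sdiff_empty] at hh
  by_cases h0 : h = 0
  · simp [h0]
  have hpos : 0 < ‖h‖ := norm_pos_iff.2 h0
  obtain ⟨c, hc1, hc⟩ := exists_unimod (f h)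
  have := key (((‖h‖⁻¹ : ℝ) : 𝕜) • c • h) (csupp_smul (csupp_smul hh c) _) (by
    rw [norm_smul, norm_smul, hc1, RCLike.norm_ofReal, abs_of_pos (inv_pos.2 hpos), one_mul,
      inv_mul_cancel₀ hpos.ne'])
  rw [f.map_smul, f.map_smul, smul_eq_mul, smul_eq_mul, hc, ← RCLike.ofReal_mul,
    RCLike.ofReal_re, inv_mul_le_iff₀ hpos] at this
  linarith [mul_comm ε ‖h‖]

lemma QB.of_locally [T2Space K] [LocallyCompactSpace K] (f : C₀(K, X) →L[𝕜] 𝕜) (O : Set K)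
    (hO : IsOpen O)
    (h : ∀ t ∈ O, ∃ W : Set K, IsOpen W ∧ t ∈ W ∧ ∀ ε > 0, QB f W ε) :
    ∀ ε > 0, QB f O ε := by
  intro ε hε
  obtain ⟨C, hC, hCO, hq⟩ := QB.regular f O (half_pos hε)
  have : ∃ W : Set K, IsOpen W ∧ C ⊆ W ∧ ∀ ε > 0, QB f W ε := by
    refine hC.induction_on (p := fun C => ∃ W : Set K, IsOpen W ∧ C ⊆ W ∧ ∀ ε > 0, QB f W ε)
      ?_ ?_ ?_ ?_
    · refine ⟨∅, isOpen_empty, subset_rfl, fun ε hε => ⟨∅, fun g hg => ?_⟩⟩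
      have : g = 0 := by
        ext t
        by_contra h
        exact (hg.2 (subset_tsupport _ h)).1
      simp [this]
    · rintro s t hst ⟨W, h1, h2, h3⟩
      exact ⟨W, h1, hst.trans h2, h3⟩
    · rintro s t ⟨W, h1, h2, h3⟩ ⟨W', h1', h2', h3'⟩
      refine ⟨W ∪ W', h1.union h1', Set.union_subset_union h2 h2', fun ε hε => ?_⟩
      have := QB.union (h3 _ (half_pos hε)) (h3' _ (half_pos hε)) h1 h1' (half_pos hε).le
        (half_pos hε).le
      rwa [add_halves] at this
    · intro t ht
      obtain ⟨W, h1, h2, h3⟩ := h t (hCO ht)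
      exact ⟨W, mem_nhdsWithin_of_mem_nhds (h1.mem_nhds h2), W, h1, subset_rfl, h3⟩
  obtain ⟨W, h1, h2, h3⟩ := this
  have := QB.union (h3 _ (half_pos hε)) hq h1 (hO.sdiff hC.isClosed) (half_pos hε).le
    (half_pos hε).le
  rw [add_halves] at this
  refine this.mono fun t ht => ?_
  by_cases htC : t ∈ C
  · exact Or.inl (h2 htC)
  · exact Or.inr ⟨ht, htC⟩

lemma QB.scattered [T2Space K] [LocallyCompactSpace K] (hK : Scattered K)
    (f : C₀(K, X) →L[𝕜] 𝕜) : ∀ ε > 0, QB f Set.univ ε := by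
  classical
  let A : Set K := {t | ¬ ∃ W : Set K, IsOpen W ∧ t ∈ W ∧ ∀ ε > 0, QB f W ε}
  have hA : ¬ A.Nonempty := by
    intro hne
    obtain ⟨a, ha, V, hV, hVa⟩ := hK A hne
    have haV : a ∈ V := by
      have : a ∈ V ∩ A := by rw [hVa]; rfl
      exact this.1
    apply ha
    refine ⟨V, hV, haV, fun ε hε => ?_⟩
    obtain ⟨F, hF⟩ := QB.of_locally f (V \ {a}) (hV.sdiff isClosed_singleton) (by
      intro t ht
      by_contra hcon
      have : t ∈ V ∩ A := ⟨ht.1, hcon⟩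
      rw [hVa] at this
      exact ht.2 this) ε hε
    refine ⟨insert a F, fun g hg => hF g ⟨hg.1, fun t ht => ?_⟩⟩
    have := hg.2 ht
    simp only [Finset.coe_insert, Set.mem_sdiff, Set.mem_insert_iff, not_or] at this
    exact ⟨⟨this.1, this.2.1⟩, this.2.2⟩
  refine QB.of_locally f Set.univ isOpen_univ fun t _ => ?_
  by_contra hcon
  exact hA ⟨t, hcon⟩

lemma exists_trunc (𝕜 : Type*) {K X : Type*} [RCLike 𝕜] [TopologicalSpace K]
    [NormedAddCommGroup X] [NormedSpace 𝕜 X] (g : C₀(K, X)) {c : ℝ} (hc : 0 < c) :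
    ∃ h : C₀(K, X), ‖g - h‖ ≤ c ∧ ‖h‖ ≤ ‖g‖ ∧ CSupp h {t | c ≤ ‖g t‖} := by
  let ψ : K → ℝ := fun s => 1 - c / max ‖g s‖ c
  have hpos : ∀ s, 0 < max ‖g s‖ c := fun s => lt_max_of_lt_right hc
  have hψ : Continuous ψ :=
    continuous_const.sub (continuous_const.div
      ((map_continuous g).norm.max continuous_const) fun s => (hpos s).ne')
  have hcl : IsClosed {t | c ≤ ‖g t‖} := isClosed_le continuous_const (map_continuous g).norm
  have hsub : tsupport (fun s => ((ψ s : ℝ) : 𝕜) • g s) ⊆ {t | c ≤ ‖g t‖} := by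
    refine closure_minimal (fun s hs => ?_) hcl
    by_contra hcon
    simp only [Set.mem_ofPred_eq, not_le] at hcon
    apply hs
    have : ψ s = 0 := by
      simp only [ψ]
      rw [max_eq_right hcon.le, div_self hc.ne', sub_self]
    simp [this]
  have hcp : IsCompact {t | c ≤ ‖g t‖} := by
    have h0 := (zero_at_infty g).norm
    rw [norm_zero] at h0
    have := h0.eventually (gt_mem_nhds hc)
    rw [Filter.Eventually, Filter.mem_cocompact] at this
    obtain ⟨C, hC, hsubC⟩ := this
    refine hC.of_isClosed_subset hcl fun t ht => ?_
    by_contra hcon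
    have h1 : ‖g t‖ < c := hsubC hcon
    have h2 : c ≤ ‖g t‖ := ht
    linarith
  have hcp' := hcp.of_isClosed_subset (isClosed_tsupport _) hsub
  obtain ⟨h, hh⟩ := exists_c0 (fun s => ((ψ s : ℝ) : 𝕜) • g s)
    ((RCLike.continuous_ofReal.comp hψ).smul (map_continuous g)) hcp'
  have hfun : (h : K → X) = fun s => ((ψ s : ℝ) : 𝕜) • g s := funext hh
  have hd0 : ∀ s, 0 ≤ c / max ‖g s‖ c := fun s => div_nonneg hc.le (hpos s).le
  have hd1 : ∀ s, c / max ‖g s‖ c ≤ 1 := fun s => (div_le_one (hpos s)).2 (le_max_right _ _)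
  refine ⟨h, c0_norm_le hc.le fun t => ?_, c0_norm_le (norm_nonneg _) fun t => ?_, ?_, ?_⟩
  · have : (g - h) t = ((c / max ‖g t‖ c : ℝ) : 𝕜) • g t := by
      rw [ZeroAtInftyContinuousMap.sub_apply, hh]
      simp only [ψ]
      rw [RCLike.ofReal_sub, RCLike.ofReal_one, sub_smul, one_smul, sub_sub_cancel]
    rw [this, norm_smul, RCLike.norm_ofReal, abs_of_nonneg (hd0 t), div_mul_eq_mul_div,
      div_le_iff₀ (hpos t)]
    gcongr
    exact le_max_left _ _
  · rw [hh, norm_smul, RCLike.norm_ofReal, abs_of_nonneg (by simp only [ψ]; linarith [hd1 t])]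
    calc ψ t * ‖g t‖ ≤ 1 * ‖g t‖ := by
          gcongr; simp only [ψ]; linarith [hd0 t]
      _ ≤ ‖g‖ := by rw [one_mul]; exact c0_le g t
  · rw [hfun]; exact hcp'
  · rw [hfun]; exact hsub

lemma functional_small [T2Space K] [LocallyCompactSpace K] (hK : Scattered K)
    (f : C₀(K, X) →L[𝕜] 𝕜) {ε : ℝ} (hε : 0 < ε) :
    ∃ F : Finset K, ∃ η : ℝ, 0 < η ∧ ∀ g : C₀(K, X), ‖g‖ ≤ 2 → (∀ t ∈ F, ‖g t‖ < η) →
      ‖f g‖ < ε := by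
  obtain ⟨F, hF⟩ := QB.scattered hK f (ε / 8) (by linarith)
  have hn : 0 < ‖f‖ + 1 := by positivity
  refine ⟨F, ε / (2 * (‖f‖ + 1)), by positivity, fun g hg hgF => ?_⟩
  obtain ⟨h, h1, h2, h3⟩ := exists_trunc (𝕜 := 𝕜) g (c := ε / (2 * (‖f‖ + 1))) (by positivity)
  have hb := hF h ⟨h3.1, fun t ht => ⟨trivial, fun htF => absurd (hgF t htF) (not_lt.2 (h3.2 ht))⟩⟩
  have e : f g = f (g - h) + f h := by rw [map_sub]; ring
  have hb2 : ‖f (g - h)‖ ≤ ε / 2 := by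
    calc ‖f (g - h)‖ ≤ ‖f‖ * ‖g - h‖ := f.le_opNorm _
      _ ≤ (‖f‖ + 1) * (ε / (2 * (‖f‖ + 1))) := by gcongr; linarith
      _ = ε / 2 := by field_simp
  have hb3 : ‖f h‖ ≤ ε / 4 := by
    calc ‖f h‖ ≤ ε / 8 * ‖h‖ := hb
      _ ≤ ε / 8 * 2 := by gcongr; exact h2.trans hg
      _ = ε / 4 := by ring
  calc ‖f g‖ ≤ ‖f (g - h)‖ + ‖f h‖ := by rw [e]; exact norm_add_le _ _
    _ < ε := by linarith

lemma weak_nhds [T2Space K] [LocallyCompactSpace K] (hK : Scattered K) {V : Set C₀(K, X)}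
    (hV : IsOpen[weakTop 𝕜 C₀(K, X)] V) {u : C₀(K, X)} (hu : u ∈ V) (hu1 : ‖u‖ ≤ 1) :
    ∃ F : Finset K, ∃ η : ℝ, 0 < η ∧ ∀ v : C₀(K, X), ‖v‖ ≤ 1 → (∀ t ∈ F, ‖v t - u t‖ < η) →
      v ∈ V := by
  classical
  obtain ⟨W, hW, rfl⟩ := isOpen_induced_iff.1 hV
  obtain ⟨I, w, hw, hIw⟩ := isOpen_pi_iff.1 hW _ hu
  have h1 : ∀ f : C₀(K, X) →L[𝕜] 𝕜, ∃ ε : ℝ, 0 < ε ∧ (f ∈ I → ball (f u) ε ⊆ w f) := by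
    intro f
    by_cases hf : f ∈ I
    · obtain ⟨ε, h, h'⟩ := Metric.isOpen_iff.1 (hw f hf).1 _ (hw f hf).2
      exact ⟨ε, h, fun _ => h'⟩
    · exact ⟨1, one_pos, fun h => absurd h hf⟩
  choose ε hε hball using h1
  choose F η hη hF using fun f => functional_small hK f (hε f)
  obtain ⟨η₀, hη₀, hle⟩ : ∃ η₀ : ℝ, 0 < η₀ ∧ ∀ f ∈ I, η₀ ≤ η f := by
    by_cases hI : I.Nonempty
    · exact ⟨I.inf' hI η, (Finset.lt_inf'_iff _).2 fun f _ => hη f,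
        fun f hf => Finset.inf'_le _ hf⟩
    · exact ⟨1, one_pos, fun f hf => absurd ⟨f, hf⟩ hI⟩
  refine ⟨I.biUnion F, η₀, hη₀, fun v hv hvu => ?_⟩
  refine hIw fun f hf => hball f hf ?_
  rw [mem_ball, dist_eq_norm, ← map_sub]
  refine hF f (v - u) ?_ fun t ht => ?_
  · calc ‖v - u‖ ≤ ‖v‖ + ‖u‖ := norm_sub_le _ _
      _ ≤ 2 := by linarith
  · exact (hvu t (Finset.mem_biUnion.2 ⟨f, hf, ht⟩)).trans_le (hle f hf)

lemma weak_cont {E : Type*} [NormedAddCommGroup E] [NormedSpace 𝕜 E] [FiniteDimensional 𝕜 X]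
    (L : E →L[𝕜] X) : @Continuous _ _ (weakTop 𝕜 E) _ L := by
  let e : X ≃L[𝕜] (Fin (Module.finrank 𝕜 X) → 𝕜) := ContinuousLinearEquiv.ofFinrankEq (by simp)
  have h : @Continuous _ _ (weakTop 𝕜 E) _ (fun y => e (L y)) := by
    refine @continuous_pi _ _ _ (weakTop 𝕜 E) _ _ fun i => ?_
    let f : E →L[𝕜] 𝕜 :=
      (ContinuousLinearMap.proj i).comp ((e : X →L[𝕜] (Fin (Module.finrank 𝕜 X) → 𝕜)).comp L)
    have h1 : @Continuous _ _ (weakTop 𝕜 E) _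
        (fun (x : E) (f : E →L[𝕜] 𝕜) => f x) := continuous_induced_dom
    exact @Continuous.comp _ _ _ (weakTop 𝕜 E) _ _ _ _ (continuous_apply f) h1
  have h2 := @Continuous.comp _ _ _ (weakTop 𝕜 E) _ _ _ _ e.symm.continuous h
  convert h2 using 1
  ext y
  simp

lemma eval_exists (t : K) : ∃ L : C₀(K, X) →L[𝕜] X, ∀ g, L g = g t :=
  ⟨LinearMap.mkContinuous ⟨⟨fun g => g t, fun _ _ => rfl⟩, fun _ _ => rfl⟩ 1
    (fun g => by rw [one_mul]; exact c0_le g t), fun _ => rfl⟩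

lemma glue [T2Space K] [LocallyCompactSpace K] {n : ℕ} (lam : Fin n → ℝ)
    (hsum : (∑ j, lam j) = 1)
    (p : K → X) (δ : K → ℝ) (v : K → Fin n → X → X)
    (hvc : ∀ t j, ContinuousOn (v t j) (ball (p t) (δ t) ∩ closedBall 0 1))
    (hv1 : ∀ t j, ∀ z ∈ ball (p t) (δ t) ∩ closedBall (0 : X) 1, ‖v t j z‖ ≤ 1)
    (hvs : ∀ t, ∀ z ∈ ball (p t) (δ t) ∩ closedBall (0 : X) 1,
      z = ∑ j, ((lam j : ℝ) : 𝕜) • v t j z)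
    (y : C₀(K, X)) (hy : ‖y‖ ≤ 1) (F : Finset K) (hyF : ∀ t ∈ F, ‖y t - p t‖ < δ t) :
    ∃ w : Fin n → C₀(K, X), (∀ j, ‖w j‖ ≤ 1) ∧ (∀ s, y s = ∑ j, ((lam j : ℝ) : 𝕜) • w j s) ∧
      ∀ t ∈ F, ∀ j, w j t = v t j (y t) := by
  classical
  induction F using Finset.induction_on with
  | empty =>
    refine ⟨fun _ => y, fun _ => hy, fun s => ?_, by simp⟩
    rw [← Finset.sum_smul, ← RCLike.ofReal_sum, hsum, RCLike.ofReal_one, one_smul]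
  | insert a F haF ih =>
    obtain ⟨w, hw1, hws, hwF⟩ := ih fun t ht => hyF t (Finset.mem_insert_of_mem ht)
    let O : Set K := {s | ‖y s - p a‖ < δ a} \ F
    have hO : IsOpen O :=
      (isOpen_lt ((map_continuous y).sub continuous_const).norm continuous_const).sdiff
        F.finite_toSet.isClosed
    have haO : a ∈ O := ⟨hyF a (Finset.mem_insert_self _ _), haF⟩
    have hmem : ∀ s ∈ O, y s ∈ ball (p a) (δ a) ∩ closedBall (0 : X) 1 := fun s hs =>
      ⟨by rw [mem_ball, dist_eq_norm]; exact hs.1,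
        by rw [mem_closedBall, dist_zero_right]; exact (c0_le y s).trans hy⟩
    obtain ⟨φ, hφ1, hφc, hφO, hφI⟩ := exists_continuousMap_one_of_isCompact_subset_isOpen
      (isCompact_singleton (x := a)) hO (Set.singleton_subset_iff.2 haO)
    have hts : ∀ j, tsupport (fun s => ((φ s : ℝ) : 𝕜) • (v a j (y s) - w j s)) ⊆ tsupport φ := by
      intro j
      refine closure_mono fun s hs => ?_
      simp only [Function.mem_support, ne_eq, smul_eq_zero, not_or, RCLike.ofReal_eq_zero] at hs
      exact hs.1
    have hex : ∀ j, ∃ q : C₀(K, X), ∀ s, q s = ((φ s : ℝ) : 𝕜) • (v a j (y s) - w j s) := by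
      intro j
      refine exists_c0 _ ?_ (hφc.of_isClosed_subset (isClosed_tsupport _) (hts j))
      refine ContinuousOn.continuous_of_tsupport_subset (s := O) ?_ hO ((hts j).trans hφO)
      refine ContinuousOn.smul (RCLike.continuous_ofReal.comp φ.continuous).continuousOn ?_
      refine ContinuousOn.sub ?_ (map_continuous (w j)).continuousOn
      exact (hvc a j).comp (map_continuous y).continuousOn hmem
    choose q hq using hex
    have hφ0 : ∀ s, s ∉ O → φ s = 0 := fun s hs =>
      image_eq_zero_of_notMem_tsupport fun h => hs (hφO h)
    refine ⟨fun j => w j + q j, fun j => c0_norm_le zero_le_one fun s => ?_, fun s => ?_, ?_⟩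
    · rw [ZeroAtInftyContinuousMap.add_apply, hq]
      by_cases hs : s ∈ O
      · have e : w j s + ((φ s : ℝ) : 𝕜) • (v a j (y s) - w j s)
            = ((1 - φ s : ℝ) : 𝕜) • w j s + ((φ s : ℝ) : 𝕜) • v a j (y s) := by
          rw [RCLike.ofReal_sub, RCLike.ofReal_one, sub_smul, one_smul, smul_sub]; abel
        rw [e]
        refine (norm_add_le _ _).trans ?_
        rw [norm_smul, norm_smul, RCLike.norm_ofReal, RCLike.norm_ofReal,
          abs_of_nonneg (hφI s).1, abs_of_nonneg (sub_nonneg.2 (hφI s).2)]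
        have h1 := mul_le_mul_of_nonneg_left ((c0_le (w j) s).trans (hw1 j))
          (sub_nonneg.2 (hφI s).2)
        have h2 := mul_le_mul_of_nonneg_left (hv1 a j _ (hmem s hs)) (hφI s).1
        linarith
      · rw [hφ0 s hs, RCLike.ofReal_zero, zero_smul, add_zero]
        exact (c0_le (w j) s).trans (hw1 j)
    · simp only [ZeroAtInftyContinuousMap.add_apply, hq, smul_add, Finset.sum_add_distrib]
      rw [← hws]
      by_cases hs : s ∈ O
      · have : ∑ j, ((lam j : ℝ) : 𝕜) • ((φ s : ℝ) : 𝕜) • (v a j (y s) - w j s) =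
            ((φ s : ℝ) : 𝕜) • (∑ j, ((lam j : ℝ) : 𝕜) • v a j (y s)
              - ∑ j, ((lam j : ℝ) : 𝕜) • w j s) := by
          rw [← Finset.sum_sub_distrib, Finset.smul_sum]
          refine Finset.sum_congr rfl fun j _ => ?_
          rw [smul_comm, smul_sub ((lam j : ℝ) : 𝕜)]
        rw [this, ← hws, ← hvs a _ (hmem s hs), sub_self, smul_zero, add_zero]
      · simp [hφ0 s hs]
    · intro t ht j
      rw [ZeroAtInftyContinuousMap.add_apply, hq]
      rcases Finset.mem_insert.1 ht with rfl | ht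
      · have : φ t = 1 := hφ1 rfl
        rw [this, RCLike.ofReal_one, one_smul, add_sub_cancel]
      · rw [hφ0 t fun h => h.2 ht, RCLike.ofReal_zero, zero_smul, add_zero]
        exact hwF t ht j

lemma hasCoN_one (z : X) : HasCoN 𝕜 1 z := by
  intro xs lam hxs hlam hsum hz ε hε
  have h1 : lam 0 = 1 := by simpa using hsum
  have hz' : z = xs 0 := by simpa [h1] using hz
  refine ⟨ε, hε, fun _ u => u, fun _ => continuous_subtype_val, fun u => ⟨fun _ => ?_, ?_, ?_⟩⟩
  · simpa using u.2.2
  · simp [h1]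
  · intro j
    rw [Subsingleton.elim j 0, ← hz', ← dist_eq_norm]
    exact u.2.1

end Aux

open ZeroAtInfty in
/-- Core theorem for `C₀(K, X)`: if `x ∈ B_{C₀(K,X)}` is such that every
`x t` has property (co), then `x` is a relatively weakly interior point of every finite
convex combination of relatively weakly open subsets of the unit ball containing it. -/
theorem stmt3 {𝕜 K X : Type*} [RCLike 𝕜] [TopologicalSpace K] [LocallyCompactSpace K]
    [T2Space K] [NormedAddCommGroup X] [NormedSpace 𝕜 X] [FiniteDimensional 𝕜 X]
    (hK : Scattered K) (x : C₀(K, X)) (hx : ‖x‖ ≤ 1)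
    (hco : ∀ t : K, HasCoPt 𝕜 (x t))
    (n : ℕ) (U : Fin n → Set C₀(K, X)) (lam : Fin n → ℝ)
    (hU : ∀ j, RelWeakOpen 𝕜 (U j)) (hlam : ∀ j, 0 < lam j) (hsum : (∑ j, lam j) = 1)
    (hxC : x ∈ ConvComb 𝕜 lam U) :
    RelWeakInterior 𝕜 (ConvComb 𝕜 lam U) x := by
  classical
  have hn : n ≠ 0 := by
    rintro rfl
    simp at hsum
  have hcoN : ∀ t, HasCoN 𝕜 n (x t) := by
    intro t
    by_cases h1 : n = 1
    · subst h1
      exact hasCoN_one _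
    · exact hco t n (by omega)
  obtain ⟨u, huU, hxu⟩ := hxC
  choose V hV hUV using fun j => (hU j).2
  have huV : ∀ j, u j ∈ V j ∧ ‖u j‖ ≤ 1 := by
    intro j
    have := huU j
    rw [hUV j] at this
    exact ⟨this.1, by simpa using this.2⟩
  choose F η hη hF using fun j => weak_nhds hK (hV j) (huV j).1 (huV j).2
  obtain ⟨η₀, hη₀, hle⟩ : ∃ η₀ : ℝ, 0 < η₀ ∧ ∀ j, η₀ ≤ η j := by
    have : (Finset.univ : Finset (Fin n)).Nonempty := ⟨⟨0, by omega⟩, Finset.mem_univ _⟩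
    exact ⟨Finset.univ.inf' this η, (Finset.lt_inf'_iff _).2 fun f _ => hη f,
      fun f => Finset.inf'_le _ (Finset.mem_univ f)⟩
  have happ : ∀ (w : Fin n → C₀(K, X)) (t : K),
      (∑ j, ((lam j : ℝ) : 𝕜) • w j) t = ∑ j, ((lam j : ℝ) : 𝕜) • w j t := by
    intro w t
    obtain ⟨L, hL⟩ := eval_exists (𝕜 := 𝕜) (X := X) t
    rw [← hL, map_sum]
    refine Finset.sum_congr rfl fun j _ => ?_
    rw [L.map_smul, hL]
  have hxt : ∀ t, x t = ∑ j, ((lam j : ℝ) : 𝕜) • u j t := by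
    intro t
    rw [← happ, ← hxu]
  choose δ hδ v hvc hv using fun t => hcoN t (fun j => u j t) lam
    (fun j => (c0_le (u j) t).trans (huV j).2) hlam hsum (hxt t) η₀ hη₀
  let v' : K → Fin n → X → X := fun t j z =>
    if h : z ∈ (ball (x t) (δ t) ∩ closedBall 0 1 : Set X) then v t j ⟨z, h⟩ else 0
  have hv' : ∀ t j z (h : z ∈ (ball (x t) (δ t) ∩ closedBall 0 1 : Set X)),
      v' t j z = v t j ⟨z, h⟩ := fun t j z h => dif_pos h
  let G : Finset K := Finset.univ.biUnion F
  refine ⟨{y | ∀ t ∈ G, ‖y t - x t‖ < δ t}, ?_, ?_, ?_⟩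
  · have : {y : C₀(K, X) | ∀ t ∈ G, ‖y t - x t‖ < δ t}
        = ⋂ t ∈ G, {y : C₀(K, X) | ‖y t - x t‖ < δ t} := by
      ext y; simp
    rw [this]
    refine @isOpen_biInter_finset _ _ (weakTop 𝕜 C₀(K, X)) _ _ fun t _ => ?_
    obtain ⟨L, hL⟩ := eval_exists (𝕜 := 𝕜) (X := X) t
    have := (@continuous_def _ _ (weakTop 𝕜 C₀(K, X)) _ _).1 (weak_cont L) _ (isOpen_ball (x := x t) (ε := δ t))
    convert this using 1
    ext y
    simp [dist_eq_norm, hL]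
  · intro t _
    simpa using hδ t
  · rintro y ⟨hyG, hy1⟩
    have hy1' : ‖y‖ ≤ 1 := by simpa using hy1
    obtain ⟨w, hw1, hws, hwG⟩ := glue (𝕜 := 𝕜) lam hsum (fun t => x t) δ v'
      (fun t j => by
        rw [continuousOn_iff_continuous_domRestrict]
        convert hvc t j using 1
        ext z
        exact hv' t j z z.2)
      (fun t j z hz => by rw [hv' t j z hz]; exact (hv t _).1 j)
      (fun t z hz => by
        have := (hv t ⟨z, hz⟩).2.1
        simp only [hv' t _ z hz]
        exact this)
      y hy1' G hyG
    refine ⟨w, fun j => ?_, ?_⟩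
    · rw [hUV j]
      refine ⟨hF j (w j) (hw1 j) fun t ht => ?_, by simpa using hw1 j⟩
      have htG : t ∈ G := Finset.mem_biUnion.2 ⟨j, Finset.mem_univ _, ht⟩
      have hz : y t ∈ (ball (x t) (δ t) ∩ closedBall 0 1 : Set X) :=
        ⟨by rw [mem_ball, dist_eq_norm]; exact hyG t htG,
          by rw [mem_closedBall, dist_zero_right]; exact (c0_le y t).trans hy1'⟩
      rw [hwG t htG j, hv' t j _ hz]
      exact ((hv t _).2.2 j).trans_le (hle j)
    · ext t
      rw [happ, hws]
end

section
/- Let K be a scattered locally compact Hausdorff space and let X be a finite dimensional Banach space with property (co). Then C_0(K,X) has property CWO. -/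
open Metric Topology

section helpers

open ZeroAtInfty Set Filter

lemma aux_totDisc {K : Type*} [TopologicalSpace K] [T2Space K] (hK : Scattered K) :
    TotallyDisconnectedSpace K := by
  constructor
  intro t _ ht x hx y hy
  obtain ⟨a, ha, U, hU, hUt⟩ := hK t ⟨x, hx⟩
  have key : ∀ z ∈ t, z = a := by
    intro z hz
    by_contra hne
    have haU : a ∈ U := by
      have : a ∈ U ∩ t := by rw [hUt]; rfl
      exact this.1
    have := ht U {a}ᶜ hU isOpen_compl_singleton
      (fun w hw => by
        by_cases h : w = a
        · left; rw [h]; exact haU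
        · right; exact h) ⟨a, ha, haU⟩ ⟨z, hz, hne⟩
    obtain ⟨w, hw, hwU, hwa⟩ := this
    have : w ∈ U ∩ t := ⟨hwU, hw⟩
    rw [hUt] at this
    exact hwa this
  rw [key x hx, key y hy]

variable {𝕜 K X : Type*} [RCLike 𝕜] [TopologicalSpace K]
  [NormedAddCommGroup X] [NormedSpace 𝕜 X]

lemma aux_norm_le {h : C₀(K, X)} {c : ℝ} (hc : 0 ≤ c) : ‖h‖ ≤ c ↔ ∀ x, ‖h x‖ ≤ c := by
  rw [← ZeroAtInftyContinuousMap.norm_toBCF_eq_norm, BoundedContinuousFunction.norm_le hc]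
  rfl

lemma aux_apply_le (h : C₀(K, X)) (x : K) : ‖h x‖ ≤ ‖h‖ :=
  (aux_norm_le (norm_nonneg h)).1 le_rfl x

/-- Restriction of a function to a clopen set. -/
noncomputable def cutFn (W : Set K) (hW : IsClopen W) (h : C₀(K, X)) : C₀(K, X) where
  toFun := W.indicator h
  continuous_toFun := by
    classical
    exact Continuous.indicator (by simp [hW.frontier_eq]) h.continuous
  zero_at_infty' := by
    have h0 : Tendsto (fun x => ‖h x‖) (cocompact K) (𝓝 0) := by
      simpa using h.zero_at_infty'.norm
    exact squeeze_zero_norm (fun x => norm_indicator_le_norm_self _ _) h0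

lemma cutFn_apply (W : Set K) (hW : IsClopen W) (h : C₀(K, X)) (x : K) :
    cutFn W hW h x = W.indicator h x := rfl

lemma cutFn_of_mem {W : Set K} (hW : IsClopen W) (h : C₀(K, X)) {x : K} (hx : x ∈ W) :
    cutFn W hW h x = h x := by rw [cutFn_apply, indicator_of_mem hx]

lemma cutFn_of_notMem {W : Set K} (hW : IsClopen W) (h : C₀(K, X)) {x : K} (hx : x ∉ W) :
    cutFn W hW h x = 0 := by rw [cutFn_apply, indicator_of_notMem hx]

lemma cutFn_apply_le (W : Set K) (hW : IsClopen W) (h : C₀(K, X)) (x : K) :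
    ‖cutFn W hW h x‖ ≤ ‖h x‖ := norm_indicator_le_norm_self _ _

lemma cutFn_norm_le (W : Set K) (hW : IsClopen W) (h : C₀(K, X)) :
    ‖cutFn W hW h‖ ≤ ‖h‖ :=
  (aux_norm_le (norm_nonneg h)).2 fun x => (cutFn_apply_le W hW h x).trans (aux_apply_le h x)

lemma cutFn_add (W : Set K) (hW : IsClopen W) (h : C₀(K, X)) :
    cutFn W hW h + cutFn Wᶜ hW.compl h = h := by
  ext x
  by_cases hx : x ∈ W
  · rw [ZeroAtInftyContinuousMap.add_apply, cutFn_of_mem hW h hx,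
      cutFn_of_notMem hW.compl h (by simpa using hx), add_zero]
  · rw [ZeroAtInftyContinuousMap.add_apply, cutFn_of_notMem hW h hx,
      cutFn_of_mem hW.compl h hx, zero_add]

/-- On functions supported in `S`, the functional is small if the function is small on a
suitable finite set. -/
def GoodSet (φ : C₀(K, X) →L[𝕜] 𝕜) (S : Set K) : Prop :=
  ∀ ε : ℝ, 0 < ε → ∃ F : Finset K, ∃ δ : ℝ, 0 < δ ∧ ∀ h : C₀(K, X), ‖h‖ ≤ 1 →
    (∀ x, x ∉ S → h x = 0) → (∀ k ∈ F, ‖h k‖ < δ) → ‖φ h‖ ≤ ε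

lemma GoodSet.mono {φ : C₀(K, X) →L[𝕜] 𝕜} {S T : Set K} (hT : GoodSet φ T) (hST : S ⊆ T) :
    GoodSet φ S := by
  intro ε hε
  obtain ⟨F, δ, hδ, H⟩ := hT ε hε
  exact ⟨F, δ, hδ, fun h h1 h2 h3 => H h h1 (fun x hx => h2 x fun hx' => hx (hST hx')) h3⟩

lemma GoodSet.union {φ : C₀(K, X) →L[𝕜] 𝕜} {S T : Set K} (hS : GoodSet φ S) (hT : GoodSet φ T)
    (hSc : IsClopen S) : GoodSet φ (S ∪ T) := by
  classical
  intro ε hε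
  obtain ⟨F, δ, hδ, H⟩ := hS (ε / 2) (by positivity)
  obtain ⟨F', δ', hδ', H'⟩ := hT (ε / 2) (by positivity)
  refine ⟨F ∪ F', min δ δ', lt_min hδ hδ', fun h h1 h2 h3 => ?_⟩
  rw [← cutFn_add S hSc h, map_add]
  refine (norm_add_le _ _).trans ?_
  have e1 : ‖φ (cutFn S hSc h)‖ ≤ ε / 2 := by
    refine H _ ((cutFn_norm_le _ _ _).trans h1) (fun x hx => cutFn_of_notMem _ _ hx) ?_
    intro k hk
    exact (cutFn_apply_le _ _ _ _).trans_lt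
      ((h3 k (Finset.mem_union_left _ hk)).trans_le (min_le_left _ _))
  have e2 : ‖φ (cutFn Sᶜ hSc.compl h)‖ ≤ ε / 2 := by
    refine H' _ ((cutFn_norm_le _ _ _).trans h1) (fun x hx => ?_) ?_
    · by_cases hxS : x ∈ S
      · exact cutFn_of_notMem _ _ (by simpa using hxS)
      · rw [cutFn_of_mem _ _ hxS]
        exact h2 x (by simp [hx, hxS])
    intro k hk
    exact (cutFn_apply_le _ _ _ _).trans_lt
      ((h3 k (Finset.mem_union_right _ hk)).trans_le (min_le_right _ _))
  linarith

lemma goodSet_empty (φ : C₀(K, X) →L[𝕜] 𝕜) : GoodSet φ (∅ : Set K) := by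
  intro ε hε
  refine ⟨∅, 1, one_pos, fun h _ h2 _ => ?_⟩
  have : h = 0 := by ext x; exact h2 x (by simp)
  rw [this, map_zero, norm_zero]; exact hε.le

lemma goodSet_compact {φ : C₀(K, X) →L[𝕜] 𝕜} {C : Set K} (hC : IsCompact C)
    (H : ∀ x ∈ C, ∃ G, IsClopen G ∧ x ∈ G ∧ GoodSet φ G) :
    ∃ G, IsClopen G ∧ C ⊆ G ∧ GoodSet φ G := by
  refine hC.induction_on (p := fun C => ∃ G, IsClopen G ∧ C ⊆ G ∧ GoodSet φ G) ?_ ?_ ?_ ?_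
  · exact ⟨∅, isClopen_empty, subset_rfl, goodSet_empty φ⟩
  · rintro s t hst ⟨G, h1, h2, h3⟩
    exact ⟨G, h1, hst.trans h2, h3⟩
  · rintro s t ⟨G, h1, h2, h3⟩ ⟨G', h1', h2', h3'⟩
    exact ⟨G ∪ G', h1.union h1', union_subset_union h2 h2', h3.union h3' h1⟩
  · intro x hx
    obtain ⟨G, h1, h2, h3⟩ := H x hx
    exact ⟨G, mem_nhdsWithin_of_mem_nhds (h1.isOpen.mem_nhds h2), G, h1, subset_rfl, h3⟩

lemma isCompact_ge (h : C₀(K, X)) {η : ℝ} (hη : 0 < η) : IsCompact {x | η ≤ ‖h x‖} := by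
  have h0 : Tendsto (fun x => ‖h x‖) (cocompact K) (𝓝 0) := by
    simpa using h.zero_at_infty'.norm
  have h1 := h0.eventually (gt_mem_nhds hη)
  obtain ⟨t, ht, hts⟩ := mem_cocompact.1 h1
  refine ht.of_isClosed_subset (isClosed_le continuous_const h.continuous.norm) ?_
  intro x hx
  by_contra hxt
  have : ‖h x‖ < η := hts hxt
  exact absurd hx (not_le.2 this)

/-- The key exhaustion step. -/
lemma goodSet_step {φ : C₀(K, X) →L[𝕜] 𝕜} {Z W : Set K} (hZf : Z.Finite)
    (hZ : ∀ O : Set K, IsOpen O → Z ⊆ O → ∃ Q, IsClopen Q ∧ Z ⊆ Q ∧ Q ⊆ O)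
    (H : ∀ x ∈ W, x ∉ Z → ∃ G, IsClopen G ∧ x ∈ G ∧ GoodSet φ G) : GoodSet φ W := by
  classical
  intro ε₀ hε₀
  obtain ⟨ε, hε, hεε⟩ : ∃ ε : ℝ, 0 < ε ∧ 4 * ε ≤ ε₀ := ⟨ε₀ / 4, by positivity, by linarith⟩
  have hφ1 : 0 < ‖φ‖ + 1 := by positivity
  let Hs : Set C₀(K, X) := {h | ‖h‖ ≤ 1 ∧ (∀ x, x ∉ W → h x = 0) ∧ ∀ x ∈ Z, h x = 0}
  have hbd : BddAbove ((fun h => RCLike.re (φ h)) '' Hs) := by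
    refine ⟨‖φ‖, ?_⟩
    rintro _ ⟨h, hh, rfl⟩
    exact (RCLike.re_le_norm _).trans (φ.unit_le_opNorm h hh.1)
  have hne : ((fun h => RCLike.re (φ h)) '' Hs).Nonempty :=
    ⟨_, 0, ⟨by simp, by simp, by simp⟩, rfl⟩
  set s := sSup ((fun h => RCLike.re (φ h)) '' Hs) with hs
  obtain ⟨_, ⟨h0, hh0, rfl⟩, hlt⟩ := exists_lt_of_lt_csSup hne (show s - ε < s by linarith)
  let η := ε / (‖φ‖ + 1)
  have hη : 0 < η := by positivity
  have hφη : ‖φ‖ * η ≤ ε := by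
    have : (‖φ‖ + 1) * η = ε := by simp only [η]; field_simp
    nlinarith
  obtain ⟨G, hGc, hCG, hG⟩ := goodSet_compact (φ := φ) (isCompact_ge h0 hη) (fun x hx => by
    refine H x ?_ ?_
    · by_contra hxW
      have := hh0.2.1 x hxW
      simp only [mem_setOf_eq, this, norm_zero] at hx
      linarith
    · intro hxZ
      have := hh0.2.2 x hxZ
      simp only [mem_setOf_eq, this, norm_zero] at hx
      linarith)
  obtain ⟨Q, hQc, hZQ, hQ⟩ := hZ {x | ‖h0 x‖ < η} (isOpen_lt h0.continuous.norm continuous_const)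
    (fun x hx => by simp [hh0.2.2 x hx, hη])
  let P := G \ Q
  have hPc : IsClopen P := hGc.diff hQc
  have hPg : GoodSet φ P := hG.mono diff_subset
  have hoff : ∀ x, x ∉ P → ‖h0 x‖ ≤ η := by
    intro x hx
    by_contra hc
    push Not at hc
    exact hx ⟨hCG (le_of_lt hc), fun hxQ => absurd (hQ hxQ) (not_lt.2 hc.le)⟩
  -- the truncated maximiser
  have hre : s - 2 * ε < RCLike.re (φ (cutFn P hPc h0)) := by
    have e1 : ‖cutFn Pᶜ hPc.compl h0‖ ≤ η := by
      refine (aux_norm_le hη.le).2 fun x => ?_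
      by_cases hx : x ∈ P
      · rw [cutFn_of_notMem _ _ (by simpa using hx), norm_zero]; exact hη.le
      · exact (cutFn_apply_le _ _ _ _).trans (hoff x hx)
    have e2 : ‖φ (cutFn Pᶜ hPc.compl h0)‖ ≤ ε :=
      (φ.le_opNorm _).trans ((mul_le_mul_of_nonneg_left e1 (norm_nonneg _)).trans hφη)
    have e3 := RCLike.re_le_norm (φ (cutFn Pᶜ hPc.compl h0))
    have e4 : RCLike.re (φ h0) = RCLike.re (φ (cutFn P hPc h0)) +
        RCLike.re (φ (cutFn Pᶜ hPc.compl h0)) := by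
      conv_lhs => rw [← cutFn_add P hPc h0, map_add, map_add]
    simp only at hlt
    linarith
  have hsmall : ∀ h ∈ Hs, (∀ x ∈ P, h x = 0) → ‖φ h‖ ≤ 2 * ε := by
    intro h hh hP
    obtain ⟨c, hc, hcφ⟩ := RCLike.exists_norm_eq_mul_self (φ h)
    have hmem : cutFn P hPc h0 + c • h ∈ Hs := by
      refine ⟨(aux_norm_le zero_le_one).2 fun x => ?_, fun x hx => ?_, fun x hx => ?_⟩
      · rw [ZeroAtInftyContinuousMap.add_apply, ZeroAtInftyContinuousMap.smul_apply]
        by_cases hx : x ∈ P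
        · rw [hP x hx, smul_zero, add_zero]
          exact (cutFn_apply_le _ _ _ _).trans ((aux_apply_le _ _).trans hh0.1)
        · rw [cutFn_of_notMem _ _ hx, zero_add, norm_smul, hc, one_mul]
          exact (aux_apply_le _ _).trans hh.1
      · rw [ZeroAtInftyContinuousMap.add_apply, ZeroAtInftyContinuousMap.smul_apply,
          hh.2.1 x hx, cutFn_apply]
        simp [indicator_apply, hh0.2.1 x hx]
      · rw [ZeroAtInftyContinuousMap.add_apply, ZeroAtInftyContinuousMap.smul_apply,
          hh.2.2 x hx, cutFn_apply]
        simp [indicator_apply, hh0.2.2 x hx]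
    have hle := le_csSup hbd ⟨_, hmem, rfl⟩
    rw [← hs] at hle
    simp only [map_add, map_smul, smul_eq_mul] at hle
    rw [← hcφ, RCLike.ofReal_re] at hle
    linarith
  obtain ⟨F, δ, hδ, hF⟩ := hPg ε hε
  refine ⟨F ∪ hZf.toFinset, min δ η, lt_min hδ hη, fun h h1 h2 h3 => ?_⟩
  have a1 : ‖φ (cutFn P hPc h)‖ ≤ ε := by
    refine hF _ ((cutFn_norm_le _ _ _).trans h1) (fun x hx => cutFn_of_notMem _ _ hx) ?_
    intro k hk
    exact (cutFn_apply_le _ _ _ _).trans_lt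
      ((h3 k (Finset.mem_union_left _ hk)).trans_le (min_le_left _ _))
  let u := cutFn Pᶜ hPc.compl h
  obtain ⟨R, hRc, hZR, hR⟩ := hZ {x | ‖u x‖ < η} (isOpen_lt u.continuous.norm continuous_const)
    (fun x hx => (cutFn_apply_le _ _ _ _).trans_lt
      ((h3 x (Finset.mem_union_right _ (by simpa using hx))).trans_le (min_le_right _ _)))
  have a2 : ‖φ (cutFn R hRc u)‖ ≤ ε := by
    have e1 : ‖cutFn R hRc u‖ ≤ η := by
      refine (aux_norm_le hη.le).2 fun x => ?_
      by_cases hx : x ∈ R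
      · rw [cutFn_of_mem _ _ hx]; exact le_of_lt (hR hx)
      · rw [cutFn_of_notMem _ _ hx, norm_zero]; exact hη.le
    exact (φ.le_opNorm _).trans ((mul_le_mul_of_nonneg_left e1 (norm_nonneg _)).trans hφη)
  have a3 : ‖φ (cutFn Rᶜ hRc.compl u)‖ ≤ 2 * ε := by
    refine hsmall _ ⟨?_, fun x hx => ?_, fun x hx => ?_⟩ fun x hx => ?_
    · exact (cutFn_norm_le _ _ _).trans ((cutFn_norm_le _ _ _).trans h1)
    · have := (cutFn_apply_le Rᶜ hRc.compl u x).trans (cutFn_apply_le Pᶜ hPc.compl h x)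
      rw [h2 x hx, norm_zero] at this
      exact norm_le_zero_iff.1 this
    · exact cutFn_of_notMem _ _ (by simpa using hZR hx)
    · have := cutFn_apply_le Rᶜ hRc.compl u x
      rw [cutFn_of_notMem hPc.compl h (by simpa using hx), norm_zero] at this
      exact norm_le_zero_iff.1 this
  have e : φ h = φ (cutFn P hPc h) + (φ (cutFn R hRc u) + φ (cutFn Rᶜ hRc.compl u)) := by
    rw [← map_add, cutFn_add R hRc u, ← map_add, cutFn_add P hPc h]
  rw [e]
  have b1 := norm_add_le (φ (cutFn P hPc h)) (φ (cutFn R hRc u) + φ (cutFn Rᶜ hRc.compl u))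
  have b2 := norm_add_le (φ (cutFn R hRc u)) (φ (cutFn Rᶜ hRc.compl u))
  linarith

lemma exists_clopen [LocallyCompactSpace K] [T2Space K] (hK : Scattered K) {O : Set K}
    (hO : IsOpen O) {x : K} (hx : x ∈ O) : ∃ Q, IsClopen Q ∧ x ∈ Q ∧ Q ⊆ O := by
  haveI := aux_totDisc hK
  exact (loc_compact_Haus_tot_disc_of_zero_dim (H := K)).exists_subset_of_mem_open hx hO

lemma goodSet_univ [LocallyCompactSpace K] [T2Space K] (hK : Scattered K)
    (φ : C₀(K, X) →L[𝕜] 𝕜) : GoodSet φ (univ : Set K) := by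
  have key : ∀ x : K, ∃ G, IsClopen G ∧ x ∈ G ∧ GoodSet φ G := by
    by_contra hcon
    push Not at hcon
    obtain ⟨x, hx⟩ := hcon
    obtain ⟨a, ha, U, hU, hUA⟩ :=
      hK {x | ∀ G, IsClopen G → x ∈ G → ¬ GoodSet φ G} ⟨x, hx⟩
    have haU : a ∈ U := by
      have : a ∈ U ∩ {x | ∀ G, IsClopen G → x ∈ G → ¬ GoodSet φ G} := by rw [hUA]; rfl
      exact this.1
    obtain ⟨W, hW, haW, hWU⟩ := exists_clopen hK hU haU
    refine ha W hW haW (goodSet_step (Z := {a}) (finite_singleton a) ?_ ?_)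
    · intro O hO haO
      obtain ⟨Q, h1, h2, h3⟩ := exists_clopen hK hO (haO rfl)
      exact ⟨Q, h1, by simpa using h2, h3⟩
    · intro y hy hya
      by_contra hc
      push Not at hc
      have : y ∈ U ∩ {x | ∀ G, IsClopen G → x ∈ G → ¬ GoodSet φ G} := ⟨hWU hy, hc⟩
      rw [hUA] at this
      exact hya this
  exact goodSet_step (Z := ∅) finite_empty
    (fun O _ _ => ⟨∅, isClopen_empty, subset_rfl, empty_subset _⟩) (fun x _ _ => key x)

/-- Relatively weakly open sets contain pointwise neighbourhoods. -/
lemma weak_nhd_pointwise [LocallyCompactSpace K] [T2Space K] (hK : Scattered K)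
    {V : Set C₀(K, X)} (hV : IsOpen[weakTop 𝕜 C₀(K, X)] V) {f : C₀(K, X)} (hf : f ∈ V)
    (hf1 : ‖f‖ ≤ 1) :
    ∃ F : Finset K, ∃ δ : ℝ, 0 < δ ∧ ∀ g : C₀(K, X), ‖g‖ ≤ 1 →
      (∀ k ∈ F, ‖g k - f k‖ < δ) → g ∈ V := by
  classical
  obtain ⟨t, ht, rfl⟩ := isOpen_induced_iff.1 hV
  obtain ⟨I, u, hu, hut⟩ := isOpen_pi_iff.1 ht _ hf
  have one : ∀ φ : C₀(K, X) →L[𝕜] 𝕜, φ ∈ I → ∃ F : Finset K, ∃ δ : ℝ, 0 < δ ∧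
      ∀ g : C₀(K, X), ‖g‖ ≤ 1 → (∀ k ∈ F, ‖g k - f k‖ < δ) → φ g ∈ u φ := by
    intro φ hφ
    obtain ⟨ε, hε, hball⟩ := Metric.isOpen_iff.1 (hu φ hφ).1 _ (hu φ hφ).2
    obtain ⟨F, δ, hδ, H⟩ := goodSet_univ hK φ (ε / 4) (by positivity)
    refine ⟨F, δ, hδ, fun g hg hgF => hball ?_⟩
    rw [mem_ball, dist_eq_norm, ← map_sub]
    have hn : ‖(2⁻¹ : 𝕜)‖ = 2⁻¹ := by simp
    have := H ((2⁻¹ : 𝕜) • (g - f)) ?_ (by simp) ?_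
    · rw [map_smul, norm_smul, hn] at this
      linarith
    · rw [norm_smul, hn]
      have := norm_sub_le g f
      linarith
    · intro k hk
      rw [ZeroAtInftyContinuousMap.smul_apply, norm_smul, hn, ZeroAtInftyContinuousMap.sub_apply]
      have := hgF k hk
      have := norm_nonneg (g k - f k)
      linarith
  have all : ∀ J : Finset (C₀(K, X) →L[𝕜] 𝕜), J ⊆ I → ∃ F : Finset K, ∃ δ : ℝ, 0 < δ ∧
      ∀ g : C₀(K, X), ‖g‖ ≤ 1 → (∀ k ∈ F, ‖g k - f k‖ < δ) → ∀ φ ∈ J, φ g ∈ u φ := by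
    intro J
    induction J using Finset.induction_on with
    | empty => exact fun _ => ⟨∅, 1, one_pos, by simp⟩
    | insert φ J _ ih =>
      intro hJ
      obtain ⟨F, δ, hδ, H⟩ := ih fun x hx => hJ (Finset.mem_insert_of_mem hx)
      obtain ⟨F', δ', hδ', H'⟩ := one φ (hJ (Finset.mem_insert_self _ _))
      refine ⟨F ∪ F', min δ δ', lt_min hδ hδ', fun g hg hgF ψ hψ => ?_⟩
      rcases Finset.mem_insert.1 hψ with rfl | hψ
      · exact H' g hg fun k hk =>
          (hgF k (Finset.mem_union_right _ hk)).trans_le (min_le_right _ _)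
      · exact H g hg (fun k hk =>
          (hgF k (Finset.mem_union_left _ hk)).trans_le (min_le_left _ _)) ψ hψ
  obtain ⟨F, δ, hδ, H⟩ := all I subset_rfl
  exact ⟨F, δ, hδ, fun g hg hgF => hut fun φ hφ => H g hg hgF φ hφ⟩

lemma cont_sum_smul {Y : Type*} [TopologicalSpace Y] {ι : Type*} [Fintype ι] {c : ι → Y → 𝕜}
    (b : ι → X) (hc : ∀ i, Continuous (c i)) : Continuous fun y => ∑ i, c i y • b i :=
  continuous_finsetSum _ fun i _ => (hc i).smul continuous_const

/-- Operators into finite dimensional spaces are weak-to-norm continuous. -/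
lemma weak_cont_finDim {E : Type*} [NormedAddCommGroup E] [NormedSpace 𝕜 E]
    [FiniteDimensional 𝕜 X] (T : E →L[𝕜] X) :
    @Continuous E X (weakTop 𝕜 E) _ T := by
  let b := Module.finBasis 𝕜 X
  have h1 : ∀ ψ : E →L[𝕜] 𝕜, @Continuous E 𝕜 (weakTop 𝕜 E) _ ψ := fun ψ =>
    @Continuous.comp _ _ _ (weakTop 𝕜 E) _ _
      (fun (x : E) (f : E →L[𝕜] 𝕜) => f x) (fun p : (E →L[𝕜] 𝕜) → 𝕜 => p ψ)
      (continuous_apply ψ) continuous_induced_dom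
  have h2 : (T : E → X) = fun x => ∑ i, ((b.coord i).toContinuousLinearMap.comp T) x • b i := by
    funext x
    exact (b.sum_repr (T x)).symm
  rw [h2]
  exact @cont_sum_smul _ _ _ _ _ E (weakTop 𝕜 E) _ _ _ b fun i => h1 _

/-- Evaluation at a point. -/
noncomputable def evalCLM (k : K) : C₀(K, X) →L[𝕜] X :=
  LinearMap.mkContinuous
    { toFun := fun h => h k
      map_add' := fun _ _ => rfl
      map_smul' := fun _ _ => rfl } 1 (fun h => by simpa using aux_apply_le h k)

lemma hasCoN_all (hco : PropCo 𝕜 X) (n : ℕ) (x : X) (hx : ‖x‖ ≤ 1) : HasCoN 𝕜 n x := by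
  match n with
  | 0 =>
    intro xs lam _ _ h
    simp at h
  | 1 =>
    intro xs lam _ _ hl hxx ε hε
    have hl0 : lam 0 = 1 := by simpa using hl
    have hxs : x = xs 0 := by simpa [hl0] using hxx
    refine ⟨ε, hε, fun _ u => u, fun _ => continuous_subtype_val, fun u => ⟨?_, ?_, ?_⟩⟩
    · intro _; simpa using u.2.2
    · simp [hl0]
    · intro j
      have := u.2.1
      rw [Subsingleton.elim j 0, ← hxs, ← dist_eq_norm]
      exact this
  | n + 2 => exact hco x hx (n + 2) (by omega)

/-- A version of (co n) with functions defined on the whole space. -/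
lemma coN_ext (hco : PropCo 𝕜 X) {n : ℕ} (xs : Fin n → X) (lam : Fin n → ℝ)
    (hxs : ∀ j, ‖xs j‖ ≤ 1) (hl : ∀ j, 0 < lam j) (hl1 : (∑ j, lam j) = 1)
    (x : X) (hx : ‖x‖ ≤ 1)
    (hxx : x = (∑ j, ((lam j : ℝ) : 𝕜) • xs j)) (ε : ℝ) (hε : 0 < ε) :
    ∃ δ : ℝ, 0 < δ ∧ ∃ v : Fin n → X → X,
      (∀ j, ContinuousOn (v j) (ball x δ ∩ closedBall 0 1)) ∧
      ∀ u ∈ (ball x δ ∩ closedBall 0 1 : Set X), (∀ j, ‖v j u‖ ≤ 1) ∧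
        u = (∑ j, ((lam j : ℝ) : 𝕜) • v j u) ∧ ∀ j, ‖v j u - xs j‖ < ε := by
  classical
  obtain ⟨δ, hδ, v, hv, H⟩ := hasCoN_all hco n x hx xs lam hxs hl hl1 hxx ε hε
  refine ⟨δ, hδ, fun j u => if hu : u ∈ (ball x δ ∩ closedBall 0 1 : Set X)
    then v j ⟨u, hu⟩ else 0, fun j => ?_, fun u hu => ?_⟩
  · rw [continuousOn_iff_continuous_restrict]
    convert hv j using 1
    ext u
    have hu := u.2
    simp only [restrict_apply]
    rw [dif_pos hu]
  · have := H ⟨u, hu⟩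
    simp only [dif_pos hu]
    exact this

/-- Gluing two functions along a compact clopen set. -/
lemma exists_glue {W : Set K} (hW : IsClopen W) (hWc : IsCompact W) (p : K → X)
    (hp : ContinuousOn p W) (h : C₀(K, X)) :
    ∃ q : C₀(K, X), (∀ x ∈ W, q x = p x) ∧ ∀ x, x ∉ W → q x = h x := by
  classical
  have hc : Continuous (W.piecewise p h) := by
    rw [continuous_iff_continuousAt]
    intro x
    by_cases hx : x ∈ W
    · have hn := hW.isOpen.mem_nhds hx
      refine (hp.continuousAt hn).congr ?_
      filter_upwards [hn] with y hy
      rw [piecewise_eq_of_mem _ _ _ hy]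
    · have hn := hW.compl.isOpen.mem_nhds hx
      refine (h.continuous.continuousAt).congr ?_
      filter_upwards [hn] with y hy
      rw [piecewise_eq_of_notMem _ _ _ hy]
      rfl
  refine ⟨⟨⟨W.piecewise p h, hc⟩, ?_⟩, fun x hx => piecewise_eq_of_mem _ _ _ hx,
    fun x hx => piecewise_eq_of_notMem _ _ _ hx⟩
  refine h.zero_at_infty'.congr' ?_
  filter_upwards [hWc.compl_mem_cocompact] with y hy
  exact (piecewise_eq_of_notMem _ _ _ hy).symm

lemma exists_compact_clopen [LocallyCompactSpace K] [T2Space K] (hK : Scattered K) {O : Set K}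
    (hO : IsOpen O) {x : K} (hx : x ∈ O) :
    ∃ Q, IsClopen Q ∧ IsCompact Q ∧ x ∈ Q ∧ Q ⊆ O := by
  obtain ⟨C, hC, hxC, hCO⟩ := exists_compact_subset hO hx
  obtain ⟨Q, h1, h2, h3⟩ := exists_clopen hK isOpen_interior hxC
  exact ⟨Q, h1, hC.of_isClosed_subset h1.isClosed (h3.trans interior_subset), h2,
    h3.trans (interior_subset.trans hCO)⟩

lemma convComb_norm_le {E : Type*} [NormedAddCommGroup E] [NormedSpace 𝕜 E] {n : ℕ}
    (lam : Fin n → ℝ) (hl : ∀ j, 0 < lam j) (hl1 : (∑ j, lam j) = 1) (u : Fin n → E)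
    (hu : ∀ j, ‖u j‖ ≤ 1) : ‖∑ j, ((lam j : ℝ) : 𝕜) • u j‖ ≤ 1 := by
  refine (norm_sum_le _ _).trans ?_
  rw [← hl1]
  refine Finset.sum_le_sum fun j _ => ?_
  rw [norm_smul, RCLike.norm_ofReal, abs_of_pos (hl j)]
  exact mul_le_of_le_one_right (hl j).le (hu j)

lemma comb_apply {n : ℕ} (lam : Fin n → ℝ) (u : Fin n → C₀(K, X)) (x : K) :
    (∑ j, ((lam j : ℝ) : 𝕜) • u j) x = ∑ j, ((lam j : ℝ) : 𝕜) • u j x := by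
  change evalCLM (𝕜 := 𝕜) x _ = _
  rw [map_sum]
  simp only [map_smul]
  rfl

lemma main_glue [LocallyCompactSpace K] [T2Space K] (hK : Scattered K) (hco : PropCo 𝕜 X)
    {n : ℕ} (lam : Fin n → ℝ) (hl : ∀ j, 0 < lam j) (hl1 : (∑ j, lam j) = 1)
    (f : Fin n → C₀(K, X)) (hf : ∀ j, ‖f j‖ ≤ 1) (ε : ℝ) (hε : 0 < ε) (F : Finset K) :
    ∃ δ : K → ℝ, (∀ k, 0 < δ k) ∧ ∀ g : C₀(K, X), ‖g‖ ≤ 1 →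
      (∀ k ∈ F, ‖g k - (∑ j, ((lam j : ℝ) : 𝕜) • f j) k‖ < δ k) →
      ∃ h : Fin n → C₀(K, X), (∀ j, ‖h j‖ ≤ 1) ∧ g = ∑ j, ((lam j : ℝ) : 𝕜) • h j ∧
        ∀ j, ∀ k ∈ F, ‖h j k - f j k‖ < ε := by
  classical
  have hfk : ∀ k j, ‖f j k‖ ≤ 1 := fun k j => (aux_apply_le _ _).trans (hf j)
  have hx : ∀ k : K, ‖(∑ j, ((lam j : ℝ) : 𝕜) • f j) k‖ ≤ 1 := fun k =>
    (aux_apply_le _ _).trans (convComb_norm_le lam hl hl1 f hf)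
  choose δ hδ v hv H using fun k : K => coN_ext hco (fun j => f j k) lam (hfk k) hl hl1 _ (hx k)
    (comb_apply lam f k) ε hε
  refine ⟨δ, hδ, fun g hg => ?_⟩
  induction F using Finset.induction_on with
  | empty =>
    intro _
    refine ⟨fun _ => g, fun _ => hg, ?_, by simp⟩
    rw [← Finset.sum_smul, ← RCLike.ofReal_sum, hl1, RCLike.ofReal_one, one_smul]
  | insert k F hkF ih =>
    intro hgF
    obtain ⟨h, h1, h2, h3⟩ := ih fun k' hk' => hgF k' (Finset.mem_insert_of_mem hk')
    have hgk := hgF k (Finset.mem_insert_self _ _)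
    obtain ⟨W, hW, hWc, hkW, hWO⟩ := exists_compact_clopen hK
      (O := {x | ‖g x - (∑ j, ((lam j : ℝ) : 𝕜) • f j) k‖ < δ k} ∩ (F : Set K)ᶜ)
      ((isOpen_lt (g.continuous.sub continuous_const).norm continuous_const).inter
        F.finite_toSet.isClosed.isOpen_compl) ⟨hgk, by simpa using hkF⟩
    have hmaps : ∀ x ∈ W, g x ∈
        ball ((∑ j, ((lam j : ℝ) : 𝕜) • f j) k) (δ k) ∩ closedBall (0 : X) 1 := by
      intro x hxW
      refine ⟨?_, ?_⟩
      · rw [mem_ball, dist_eq_norm]; exact (hWO hxW).1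
      · rw [mem_closedBall, dist_zero_right]; exact (aux_apply_le _ _).trans hg
    choose q hq1 hq2 using fun j => exists_glue hW hWc (fun x => v k j (g x))
      ((hv k j).comp g.continuous.continuousOn hmaps) (h j)
    refine ⟨q, fun j => (aux_norm_le zero_le_one).2 fun x => ?_, ?_, fun j k' hk' => ?_⟩
    · by_cases hxW : x ∈ W
      · rw [hq1 j x hxW]; exact (H k _ (hmaps x hxW)).1 j
      · rw [hq2 j x hxW]; exact (aux_apply_le _ _).trans (h1 j)
    · ext x
      rw [comb_apply]
      by_cases hxW : x ∈ W
      · simp only [hq1 _ x hxW]; exact (H k _ (hmaps x hxW)).2.1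
      · simp only [hq2 _ x hxW]
        rw [← comb_apply, ← h2]
    · rcases Finset.mem_insert.1 hk' with rfl | hk'
      · rw [hq1 j _ hkW]; exact (H k' _ (hmaps k' hkW)).2.2 j
      · have : k' ∉ W := fun hc => (hWO hc).2 hk'
        rw [hq2 j _ this]
        exact h3 j k' hk'

end helpers

open ZeroAtInfty in
/-- For `K` scattered locally compact Hausdorff and `X` finite dimensional
with property (co), `C₀(K, X)` has property CWO. -/
theorem stmt5 {𝕜 K X : Type*} [RCLike 𝕜] [TopologicalSpace K] [LocallyCompactSpace K]
    [T2Space K] [NormedAddCommGroup X] [NormedSpace 𝕜 X] [FiniteDimensional 𝕜 X]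
    (hK : Scattered K) (hco : PropCo 𝕜 X) :
    PropCWO 𝕜 C₀(K, X) := by
  classical
  intro n U lam hU hl hl1
  refine ⟨⋃₀ {V | IsOpen[weakTop 𝕜 C₀(K, X)] V ∧ V ∩ closedBall 0 1 ⊆ ConvComb 𝕜 lam U},
    @isOpen_sUnion _ (weakTop 𝕜 C₀(K, X)) _ fun V hV => hV.1, ?_⟩
  apply Set.Subset.antisymm
  · rintro _ ⟨f, hfU, rfl⟩
    have hf : ∀ j, ‖f j‖ ≤ 1 := fun j => by simpa using (hU j).1 (hfU j)
    refine ⟨?_, by simpa using convComb_norm_le (𝕜 := 𝕜) lam hl hl1 f hf⟩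
    have hex : ∀ j, ∃ F : Finset K, ∃ δ : ℝ, 0 < δ ∧ ∀ g : C₀(K, X), ‖g‖ ≤ 1 →
        (∀ k ∈ F, ‖g k - f j k‖ < δ) → g ∈ U j := by
      intro j
      obtain ⟨V, hV, hUV⟩ := (hU j).2
      have hfj := hfU j
      rw [hUV] at hfj
      obtain ⟨F, δ, hδ, H⟩ := weak_nhd_pointwise hK hV hfj.1 (hf j)
      refine ⟨F, δ, hδ, fun g hg hgF => ?_⟩
      rw [hUV]
      exact ⟨H g hg hgF, by simpa using hg⟩
    choose F ε hε HF using hex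
    obtain ⟨ε₀, hε₀, hle⟩ : ∃ ε₀ : ℝ, 0 < ε₀ ∧ ∀ j, ε₀ ≤ ε j := by
      have hne : (Finset.univ : Finset (Fin n)).Nonempty := by
        by_contra hc
        rw [Finset.not_nonempty_iff_eq_empty] at hc
        rw [hc] at hl1
        simp at hl1
      refine ⟨Finset.univ.inf' hne ε, ?_, fun j => Finset.inf'_le _ (Finset.mem_univ j)⟩
      rw [Finset.lt_inf'_iff]
      exact fun j _ => hε j
    obtain ⟨δ, hδ, H⟩ := main_glue hK hco lam hl hl1 f hf ε₀ hε₀ (Finset.univ.biUnion F)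
    refine ⟨⋂ k ∈ Finset.univ.biUnion F,
      (evalCLM (𝕜 := 𝕜) (X := X) k) ⁻¹' ball ((∑ j, ((lam j : ℝ) : 𝕜) • f j) k) (δ k),
      ⟨?_, ?_⟩, ?_⟩
    · letI : TopologicalSpace C₀(K, X) := weakTop 𝕜 C₀(K, X)
      exact isOpen_biInter_finset fun k _ =>
        (weak_cont_finDim (evalCLM (𝕜 := 𝕜) (X := X) k)).isOpen_preimage _ isOpen_ball
    · rintro g ⟨hg, hg1⟩
      have hg1 : ‖g‖ ≤ 1 := by simpa using hg1
      obtain ⟨h, h1, h2, h3⟩ := H g hg1 (fun k hk => by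
        have := Set.mem_iInter₂.1 hg k hk
        rw [Set.mem_preimage, mem_ball, dist_eq_norm] at this
        exact this)
      exact ⟨h, fun j => HF j _ (h1 j) fun k hk =>
        (h3 j k (Finset.mem_biUnion.2 ⟨j, Finset.mem_univ j, hk⟩)).trans_le (hle j), h2⟩
    · refine Set.mem_iInter₂.2 fun k _ => ?_
      exact mem_ball_self (hδ k)
  · rintro g ⟨⟨V, hV, hgV⟩, hg⟩
    exact hV.2 ⟨hgV, hg⟩
end

section
/- Let K be a scattered locally compact Hausdorff space and let X be a Banach space. Let f ∈ C_0(K,X)* with ‖f‖ = 1 and let ε > 0. Then there are N ∈ ℕ, points t_1,…,t_N ∈ K, and functionals x*_1,…,x*_N ∈ X* such that Σ_{j=1}^N ‖x*_j‖ ≤ 1 and, for the functional g ∈ C_0(K,X)* defined by g(z) = Σ_{j=1}^N x*_j(z(t_j)) for z ∈ C_0(K,X), one has ‖f − g‖ < ε. -/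
open Metric Topology

namespace ScatDual

open ZeroAtInfty

theorem totDisc {K : Type*} [TopologicalSpace K] [T2Space K] (hK : Scattered K) :
    TotallyDisconnectedSpace K := by
  refine ⟨fun A _ hA x hx y hy => ?_⟩
  obtain ⟨a, ha, U, hU, hUA⟩ := hK A ⟨x, hx⟩
  have key : ∀ y ∈ A, y = a := by
    intro y hy
    by_contra hne
    have haU : a ∈ U := by
      have : a ∈ U ∩ A := by rw [hUA]; rfl
      exact this.1
    obtain ⟨z, hzA, hzU, hz⟩ := hA U {a}ᶜ hU isOpen_compl_singleton
      (fun z hz => by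
        by_cases h : z = a
        · left; rw [h]; exact haU
        · right; exact h) ⟨a, ha, haU⟩ ⟨y, hy, hne⟩
    have : z ∈ U ∩ A := ⟨hzU, hzA⟩
    rw [hUA] at this
    exact hz this
  rw [key x hx, key y hy]

section
variable {𝕜 K X : Type*} [RCLike 𝕜] [TopologicalSpace K] 
  [NormedAddCommGroup X] [NormedSpace 𝕜 X]

theorem norm_apply_le (z : C₀(K, X)) (t : K) : ‖z t‖ ≤ ‖z‖ := by
  rw [← ZeroAtInftyContinuousMap.norm_toBCF_eq_norm]
  exact z.toBCF.norm_coe_le_norm t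

theorem dist_dual (f g : C₀(K, X) →L[𝕜] 𝕜) : dist f g = ‖f - g‖ :=
  dist_eq_norm (E := C₀(K, X) →L[𝕜] 𝕜) f g

theorem norm_le_of {z : C₀(K, X)} {r : ℝ} (hr : 0 ≤ r) (h : ∀ t, ‖z t‖ ≤ r) : ‖z‖ ≤ r := by
  rw [← ZeroAtInftyContinuousMap.norm_toBCF_eq_norm]
  exact (BoundedContinuousFunction.norm_le hr).2 h

variable (𝕜 X) in
/-- evaluation at a point -/
noncomputable def ev (t : K) : C₀(K, X) →L[𝕜] X :=
  LinearMap.mkContinuous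
    { toFun := fun z => z t
      map_add' := fun _ _ => rfl
      map_smul' := fun _ _ => rfl } 1 (fun z => by simpa using norm_apply_le z t)

@[simp] theorem ev_apply (t : K) (z : C₀(K, X)) : ev 𝕜 X t z = z t := rfl

/-- restriction of a function to a clopen set -/
noncomputable def res (A : TopologicalSpace.Clopens K) (z : C₀(K, X)) : C₀(K, X) where
  toFun := (A : Set K).indicator z
  continuous_toFun := (map_continuous z).indicator (by simp [A.isClopen.frontier_eq])
  zero_at_infty' := by
    refine squeeze_zero_norm (a := fun t => ‖z t‖) (fun t => ?_) ?_
    · exact norm_indicator_le_norm_self _ _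
    · simpa using (zero_at_infty z).norm

theorem res_apply (A : TopologicalSpace.Clopens K) (z : C₀(K, X)) (t : K) :
  res A z t = (A : Set K).indicator z t := rfl

variable (𝕜 X) in
/-- restriction as a continuous linear map -/
noncomputable def P (A : TopologicalSpace.Clopens K) : C₀(K, X) →L[𝕜] C₀(K, X) :=
  LinearMap.mkContinuous
    { toFun := fun z => res A z
      map_add' := fun y z => by
        ext t; simp only [res_apply, ZeroAtInftyContinuousMap.add_apply]
        by_cases h : t ∈ (A : Set K) <;> simp [h]
      map_smul' := fun c z => by
        ext t; simp only [res_apply, ZeroAtInftyContinuousMap.smul_apply, RingHom.id_apply]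
        by_cases h : t ∈ (A : Set K) <;> simp [h] } 1 (fun z => by
    rw [one_mul]
    refine norm_le_of (norm_nonneg _) fun t => ?_
    exact (norm_indicator_le_norm_self _ _).trans (norm_apply_le z t))

theorem P_mem {A : TopologicalSpace.Clopens K} (z : C₀(K, X)) {t : K} (h : t ∈ A) :
    P 𝕜 X A z t = z t := Set.indicator_of_mem (s := (A : Set K)) h _

theorem P_notMem {A : TopologicalSpace.Clopens K} (z : C₀(K, X)) {t : K} (h : t ∉ A) :
    P 𝕜 X A z t = 0 := Set.indicator_of_notMem (s := (A : Set K)) h _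

theorem norm_P_le (A : TopologicalSpace.Clopens K) (z : C₀(K, X)) : ‖P 𝕜 X A z‖ ≤ ‖z‖ := by
  refine norm_le_of (norm_nonneg _) fun t => ?_
  exact (norm_indicator_le_norm_self _ _).trans (norm_apply_le z t)

/-- constants on compact clopen sets -/
noncomputable def cst (A : TopologicalSpace.Clopens K) (hA : IsCompact (A : Set K)) (x : X) :
    C₀(K, X) where
  toFun := (A : Set K).indicator (fun _ => x)
  continuous_toFun := continuous_const.indicator (by simp [A.isClopen.frontier_eq])
  zero_at_infty' := by
    refine tendsto_const_nhds.congr' ?_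
    filter_upwards [hA.compl_mem_cocompact] with t ht
    rw [Set.indicator_of_notMem ht]

theorem cst_mem {A : TopologicalSpace.Clopens K} (hA : IsCompact (A : Set K)) (x : X)
    {t : K} (h : t ∈ A) : cst A hA x t = x :=
  Set.indicator_of_mem (s := (A : Set K)) h (fun _ => x)

theorem cst_notMem {A : TopologicalSpace.Clopens K} (hA : IsCompact (A : Set K)) (x : X)
    {t : K} (h : t ∉ A) : cst A hA x t = 0 :=
  Set.indicator_of_notMem (s := (A : Set K)) h (fun _ => x)

theorem norm_cst_le {A : TopologicalSpace.Clopens K} (hA : IsCompact (A : Set K)) (x : X) :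
    ‖cst A hA x‖ ≤ ‖x‖ := by
  refine norm_le_of (norm_nonneg _) fun t => ?_
  exact norm_indicator_le_norm_self (fun _ => x) _

variable (𝕜) in
/-- constants on compact clopen sets, as a continuous linear map -/
noncomputable def cstL (A : TopologicalSpace.Clopens K) (hA : IsCompact (A : Set K)) :
    X →L[𝕜] C₀(K, X) :=
  LinearMap.mkContinuous
    { toFun := fun x => cst A hA x
      map_add' := fun x y => by
        ext t
        by_cases h : t ∈ A
        · simp [cst_mem hA _ h]
        · simp [cst_notMem hA _ h]
      map_smul' := fun c x => by
        ext t
        by_cases h : t ∈ A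
        · simp [cst_mem hA _ h]
        · simp [cst_notMem hA _ h] } 1 (fun x => by
    rw [one_mul]; exact norm_cst_le hA x)

theorem cstL_apply (A : TopologicalSpace.Clopens K) (hA : IsCompact (A : Set K)) (x : X) :
    cstL 𝕜 A hA x = cst A hA x := rfl

theorem P_comp (A B : TopologicalSpace.Clopens K) (h : B ≤ A) (z : C₀(K, X)) :
    P 𝕜 X A (P 𝕜 X B z) = P 𝕜 X B z := by
  ext t
  by_cases hA : t ∈ A
  · rw [P_mem _ hA]
  · rw [P_notMem _ hA, P_notMem _ (fun hB => hA (h hB))]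

theorem P_comp' (A B : TopologicalSpace.Clopens K) (h : B ≤ A) (z : C₀(K, X)) :
    P 𝕜 X B (P 𝕜 X A z) = P 𝕜 X B z := by
  ext t
  by_cases hB : t ∈ B
  · rw [P_mem _ hB, P_mem _ hB, P_mem _ (h hB)]
  · rw [P_notMem _ hB, P_notMem _ hB]

theorem P_split (A B : TopologicalSpace.Clopens K) (h : B ≤ A) (z : C₀(K, X)) :
    P 𝕜 X A z = P 𝕜 X B z + P 𝕜 X (A \ B) z := by
  ext t
  rw [ZeroAtInftyContinuousMap.add_apply]
  by_cases hB : t ∈ B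
  · have : t ∉ A \ B := fun hh => hh.2 hB
    rw [P_mem _ hB, P_mem _ (h hB), P_notMem _ this, add_zero]
  · rw [P_notMem _ hB, zero_add]
    by_cases hA : t ∈ A
    · have : t ∈ A \ B := ⟨hA, hB⟩
      rw [P_mem _ hA, P_mem _ this]
    · have : t ∉ A \ B := fun hh => hA hh.1
      rw [P_notMem _ hA, P_notMem _ this]

theorem super (f : C₀(K, X) →L[𝕜] 𝕜) (A B C : TopologicalSpace.Clopens K) (hAC : A ≤ C)
    (hBC : B ≤ C) (hAB : ∀ t, t ∈ A → t ∈ B → False) :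
    ‖f ∘L P 𝕜 X A‖ + ‖f ∘L P 𝕜 X B‖ ≤ ‖f ∘L P 𝕜 X C‖ := by
  refine le_of_forall_pos_le_add fun δ hδ => ?_
  obtain ⟨z, hz, hz'⟩ := (f ∘L P 𝕜 X A).exists_lt_apply_of_lt_opNorm
    (r := ‖f ∘L P 𝕜 X A‖ - δ / 2) (by linarith)
  obtain ⟨w, hw, hw'⟩ := (f ∘L P 𝕜 X B).exists_lt_apply_of_lt_opNorm
    (r := ‖f ∘L P 𝕜 X B‖ - δ / 2) (by linarith)
  obtain ⟨c, hc, hc'⟩ := RCLike.exists_norm_eq_mul_self ((f ∘L P 𝕜 X A) z)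
  obtain ⟨d, hd, hd'⟩ := RCLike.exists_norm_eq_mul_self ((f ∘L P 𝕜 X B) w)
  set u : C₀(K, X) := P 𝕜 X A (c • z) + P 𝕜 X B (d • w) with hu
  have hu1 : ‖u‖ ≤ 1 := by
    refine norm_le_of zero_le_one fun t => ?_
    rw [hu, ZeroAtInftyContinuousMap.add_apply]
    by_cases hA : t ∈ A
    · rw [P_notMem _ (hAB t hA), P_mem _ hA, add_zero]
      rw [ZeroAtInftyContinuousMap.smul_apply, norm_smul, hc, one_mul]
      exact (norm_apply_le z t).trans hz.le
    · rw [P_notMem _ hA, zero_add]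
      refine (norm_apply_le _ t).trans ((norm_P_le B _).trans ?_)
      rw [norm_smul, hd, one_mul]; exact hw.le
  have hPu : P 𝕜 X C u = u := by
    rw [hu, map_add, P_comp _ _ hAC, P_comp _ _ hBC]
  have hfu : (f ∘L P 𝕜 X C) u
      = ((‖(f ∘L P 𝕜 X A) z‖ + ‖(f ∘L P 𝕜 X B) w‖ : ℝ) : 𝕜) := by
    rw [ContinuousLinearMap.comp_apply, hPu, RCLike.ofReal_add, hc', hd', hu]
    simp
  have h1 := (f ∘L P 𝕜 X C).le_opNorm u
  rw [hfu, RCLike.norm_ofReal, abs_of_nonneg (by positivity)] at h1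
  have h2 : ‖f ∘L P 𝕜 X C‖ * ‖u‖ ≤ ‖f ∘L P 𝕜 X C‖ :=
    mul_le_of_le_one_right (ContinuousLinearMap.opNorm_nonneg _) hu1
  linarith

variable (𝕜 X) in
/-- generator `φ ∘ δ_t` -/
noncomputable def gen (t : K) : (X →L[𝕜] 𝕜) →ₗ[𝕜] (C₀(K, X) →L[𝕜] 𝕜) where
  toFun φ := φ ∘L ev 𝕜 X t
  map_add' _ _ := by ext; simp
  map_smul' _ _ := by ext; simp

variable (𝕜 K X) in
/-- finite combinations -/
noncomputable def T : (K →₀ (X →L[𝕜] 𝕜)) →ₗ[𝕜] (C₀(K, X) →L[𝕜] 𝕜) :=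
  Finsupp.lsum 𝕜 (gen 𝕜 X)

theorem T_apply (c : K →₀ (X →L[𝕜] 𝕜)) (z : C₀(K, X)) :
    T 𝕜 K X c z = ∑ t ∈ c.support, c t (z t) := by
  simp [T, Finsupp.lsum_apply, Finsupp.sum, gen]

variable (𝕜 K X) in
/-- closure of finite combinations -/
noncomputable def D : Submodule 𝕜 (C₀(K, X) →L[𝕜] 𝕜) := (T 𝕜 K X).range.topologicalClosure

theorem gen_mem (t : K) (φ : X →L[𝕜] 𝕜) : φ ∘L ev 𝕜 X t ∈ D 𝕜 K X := by
  apply Submodule.le_topologicalClosure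
  exact ⟨Finsupp.single t φ, by simp [T, gen]⟩

theorem D_comp {g : C₀(K, X) →L[𝕜] 𝕜} (hg : g ∈ D 𝕜 K X) (B : TopologicalSpace.Clopens K) :
    g ∘L P 𝕜 X B ∈ D 𝕜 K X := by
  have hcont : Continuous fun g : C₀(K, X) →L[𝕜] 𝕜 => g ∘L P 𝕜 X B := by fun_prop
  have hmaps : ∀ g ∈ (((T 𝕜 K X).range : Submodule 𝕜 _) : Set (C₀(K, X) →L[𝕜] 𝕜)),
      g ∘L P 𝕜 X B ∈ ((D 𝕜 K X : Submodule 𝕜 _) : Set (C₀(K, X) →L[𝕜] 𝕜)) := by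
    rintro _ ⟨c, rfl⟩
    induction c using Finsupp.induction_linear with
    | zero => simp
    | add a b ha hb =>
      rw [map_add, ContinuousLinearMap.add_comp]
      exact Submodule.add_mem _ ha hb
    | single t φ =>
      have h1 : T 𝕜 K X (Finsupp.single t φ) = φ ∘L ev 𝕜 X t := by simp [T, gen]
      rw [h1]
      by_cases h : t ∈ B
      · have : (φ ∘L ev 𝕜 X t) ∘L P 𝕜 X B = φ ∘L ev 𝕜 X t := by
          ext z; simp [P_mem z h]
        rw [this]; exact gen_mem t φ
      · have : (φ ∘L ev 𝕜 X t) ∘L P 𝕜 X B = 0 := by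
          ext z; simp [P_notMem z h]
        rw [this]; exact Submodule.zero_mem _
  have hcl : IsClosed ((D 𝕜 K X : Submodule 𝕜 _) : Set (C₀(K, X) →L[𝕜] 𝕜)) :=
    Submodule.isClosed_topologicalClosure _
  have := map_mem_closure hcont hg hmaps
  rwa [hcl.closure_eq] at this

theorem D_mono {f : C₀(K, X) →L[𝕜] 𝕜} {A B : TopologicalSpace.Clopens K} (h : B ≤ A)
    (hA : f ∘L P 𝕜 X A ∈ D 𝕜 K X) : f ∘L P 𝕜 X B ∈ D 𝕜 K X := by
  have := D_comp hA B
  have e : (f ∘L P 𝕜 X A) ∘L P 𝕜 X B = f ∘L P 𝕜 X B := by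
    ext z; simp [P_comp A B h]
  rwa [e] at this

theorem D_split {f : C₀(K, X) →L[𝕜] 𝕜} {A B : TopologicalSpace.Clopens K} (h : B ≤ A) :
    f ∘L P 𝕜 X A = f ∘L P 𝕜 X B + f ∘L P 𝕜 X (A \ B) := by
  ext z; simp [P_split A B h z]

theorem D_sup {f : C₀(K, X) →L[𝕜] 𝕜} {A B : TopologicalSpace.Clopens K}
    (hA : f ∘L P 𝕜 X A ∈ D 𝕜 K X) (hB : f ∘L P 𝕜 X B ∈ D 𝕜 K X) :
    f ∘L P 𝕜 X (A ⊔ B) ∈ D 𝕜 K X := by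
  rw [D_split (le_sup_left : A ≤ A ⊔ B)]
  refine Submodule.add_mem _ hA (D_mono ?_ hB)
  rw [sup_sdiff_left_self]; exact sdiff_le

theorem D_compact (f : C₀(K, X) →L[𝕜] 𝕜) {s : Set K} (hs : IsCompact s)
    (h : ∀ t ∈ s, ∃ A : TopologicalSpace.Clopens K, t ∈ A ∧ f ∘L P 𝕜 X A ∈ D 𝕜 K X) :
    ∃ A : TopologicalSpace.Clopens K, s ⊆ A ∧ f ∘L P 𝕜 X A ∈ D 𝕜 K X := by
  refine hs.induction_on (p := fun s => ∃ A : TopologicalSpace.Clopens K,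
    s ⊆ A ∧ f ∘L P 𝕜 X A ∈ D 𝕜 K X) ?_ ?_ ?_ ?_
  · refine ⟨⊥, Set.empty_subset _, ?_⟩
    have : f ∘L P 𝕜 X (⊥ : TopologicalSpace.Clopens K) = 0 := by
      ext z
      have : P 𝕜 X (⊥ : TopologicalSpace.Clopens K) z = 0 := by
        ext t
        have h : t ∉ (⊥ : TopologicalSpace.Clopens K) := fun h => Set.notMem_empty t h
        rw [P_notMem _ h]; rfl
      simp [this]
    rw [this]; exact Submodule.zero_mem _
  · rintro s t hst ⟨A, hA, hA'⟩
    exact ⟨A, hst.trans hA, hA'⟩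
  · rintro s t ⟨A, hA, hA'⟩ ⟨B, hB, hB'⟩
    refine ⟨A ⊔ B, ?_, D_sup hA' hB'⟩
    rw [TopologicalSpace.Clopens.coe_sup]
    exact Set.union_subset_union hA hB
  · intro t ht
    obtain ⟨A, htA, hA⟩ := h t ht
    exact ⟨A, mem_nhdsWithin_of_mem_nhds (A.isClopen.isOpen.mem_nhds htA), A, subset_rfl, hA⟩

theorem exists_clopen [LocallyCompactSpace K] [T2Space K] [TotallyDisconnectedSpace K] {t : K}
    {U : Set K} (hU : IsOpen U) (ht : t ∈ U) :
    ∃ A : TopologicalSpace.Clopens K, IsCompact (A : Set K) ∧ t ∈ A ∧ (A : Set K) ⊆ U := by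
  obtain ⟨C, hC, htC, hCU⟩ := exists_compact_subset hU ht
  obtain ⟨V, hV, htV, hVC⟩ := (loc_compact_Haus_tot_disc_of_zero_dim (H := K)).exists_subset_of_mem_open
    htC isOpen_interior
  refine ⟨⟨V, hV⟩, hC.of_isClosed_subset hV.1 (hVC.trans interior_subset), htV,
    (hVC.trans interior_subset).trans hCU⟩

/-- Near a point, a functional is norm-close to a point functional, up to small clopen sets. -/
theorem near_point (f : C₀(K, X) →L[𝕜] 𝕜) [LocallyCompactSpace K] [T2Space K]
    [TotallyDisconnectedSpace K] (a : K) (V : TopologicalSpace.Clopens K)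
    (hV : IsCompact (V : Set K)) (haV : a ∈ V) (δ : ℝ) (hδ : 0 < δ) :
    ∃ W : TopologicalSpace.Clopens K, W ≤ V ∧ a ∈ W ∧ ∃ φ : X →L[𝕜] 𝕜,
      ‖f ∘L P 𝕜 X W - φ ∘L ev 𝕜 X a‖ ≤ δ := by
  let S : Set ℝ := {r | ∃ W : TopologicalSpace.Clopens K, W ≤ V ∧ a ∈ W ∧ r = ‖f ∘L P 𝕜 X W‖}
  have hSb : BddBelow S := ⟨0, by rintro _ ⟨W, -, -, rfl⟩; exact ContinuousLinearMap.opNorm_nonneg _⟩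
  have hSn : S.Nonempty := ⟨_, V, le_rfl, haV, rfl⟩
  obtain ⟨_, ⟨W, hWV, haW, rfl⟩, hlt⟩ := exists_lt_of_csInf_lt hSn
    (show sInf S < sInf S + δ / 2 by linarith)
  have hW : IsCompact (W : Set K) := hV.of_isClosed_subset W.isClopen.1 hWV
  have hsmall : ∀ W' : TopologicalSpace.Clopens K, W' ≤ W → a ∈ W' →
      ‖f ∘L P 𝕜 X (W \ W')‖ ≤ δ / 2 := by
    intro W' h1 h2
    have h3 := super f W' (W \ W') W h1 sdiff_le (fun t h h' => h'.2 h)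
    have h4 : sInf S ≤ ‖f ∘L P 𝕜 X W'‖ := csInf_le hSb ⟨W', h1.trans hWV, h2, rfl⟩
    linarith
  refine ⟨W, hWV, haW, f ∘L cstL 𝕜 W hW, ?_⟩
  refine ContinuousLinearMap.opNorm_le_bound _ hδ.le fun z => ?_
  set y : C₀(K, X) := z - cst W hW (z a) with hy
  have hyz : ‖y‖ ≤ 2 * ‖z‖ := by
    have := norm_sub_le z (cst W hW (z a))
    have h2 := norm_cst_le hW (z a)
    have h3 := norm_apply_le z a
    linarith
  have hcP : P 𝕜 X W (cst W hW (z a)) = cst W hW (z a) := by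
    ext t
    by_cases h : t ∈ W
    · rw [P_mem _ h]
    · rw [P_notMem _ h, cst_notMem _ _ h]
  have e : (f ∘L P 𝕜 X W - (f ∘L cstL 𝕜 W hW) ∘L ev 𝕜 X a) z = f (P 𝕜 X W y) := by
    rw [hy, map_sub, hcP, map_sub]; rfl
  rw [e]
  refine le_of_forall_pos_le_add fun η hη => ?_
  set θ : ℝ := η / (‖f‖ + 1) with hθ
  have hfp : 0 < ‖f‖ + 1 := by positivity
  have hθ0 : 0 < θ := by positivity
  have hya : y a = 0 := by
    rw [hy, ZeroAtInftyContinuousMap.sub_apply, cst_mem _ _ haW, sub_self]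
  have hopen : IsOpen ({t | ‖y t‖ < θ} ∩ (W : Set K)) :=
    (isOpen_lt (map_continuous y).norm continuous_const).inter W.isClopen.2
  obtain ⟨W', -, haW', hW'⟩ := exists_clopen hopen
    (show a ∈ _ from ⟨by simpa [hya] using hθ0, haW⟩)
  have hle : W' ≤ W := fun t ht => (hW' ht).2
  have h1 : ‖P 𝕜 X W' y‖ ≤ θ := by
    refine norm_le_of hθ0.le fun t => ?_
    by_cases h : t ∈ W'
    · rw [P_mem _ h]; exact (hW' h).1.le
    · rw [P_notMem _ h, norm_zero]; exact hθ0.le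
  rw [P_split W W' hle, map_add]
  have h2 : ‖f (P 𝕜 X W' y)‖ ≤ η := by
    refine (f.le_opNorm _).trans ?_
    calc ‖f‖ * ‖P 𝕜 X W' y‖ ≤ (‖f‖ + 1) * θ := by gcongr; linarith
      _ = η := by rw [hθ]; field_simp
  have h3 : ‖f (P 𝕜 X (W \ W') y)‖ ≤ δ * ‖z‖ := by
    refine ((f ∘L P 𝕜 X (W \ W')).le_opNorm y).trans ?_
    calc _ ≤ δ / 2 * (2 * ‖z‖) := by
          gcongr
          exact hsmall W' hle haW'
      _ = δ * ‖z‖ := by ring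
  have := norm_add_le (f (P 𝕜 X W' y)) (f (P 𝕜 X (W \ W') y))
  linarith

theorem all_good [LocallyCompactSpace K] [T2Space K] (hK : Scattered K)
    (f : C₀(K, X) →L[𝕜] 𝕜) (t : K) :
    ∃ A : TopologicalSpace.Clopens K, t ∈ A ∧ f ∘L P 𝕜 X A ∈ D 𝕜 K X := by
  have := totDisc hK
  by_contra hcon
  let Bad : Set K := {t | ¬ ∃ A : TopologicalSpace.Clopens K, t ∈ A ∧ f ∘L P 𝕜 X A ∈ D 𝕜 K X}
  obtain ⟨a, haB, U, hU, hUB⟩ := hK Bad ⟨t, hcon⟩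
  have haU : a ∈ U := by
    have : a ∈ U ∩ Bad := by rw [hUB]; rfl
    exact this.1
  obtain ⟨V, hV, haV, hVU⟩ := exists_clopen hU haU
  apply haB
  refine ⟨V, haV, ?_⟩
  have hcl : IsClosed ((D 𝕜 K X : Submodule 𝕜 _) : Set (C₀(K, X) →L[𝕜] 𝕜)) :=
    Submodule.isClosed_topologicalClosure _
  rw [← SetLike.mem_coe, ← hcl.closure_eq]
  refine (Metric.mem_closure_iff (α := C₀(K, X) →L[𝕜] 𝕜)).2 ?_
  intro ε hε
  obtain ⟨W, hWV, haW, φ, hφ⟩ := near_point f a V hV haV (ε / 2) (by linarith)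
  obtain ⟨A, hA, hA'⟩ := D_compact f (s := (V : Set K) \ W) (hV.diff W.isClopen.2) (by
    rintro s ⟨hs, hs'⟩
    by_contra hbad
    have : s ∈ U ∩ Bad := ⟨hVU hs, hbad⟩
    rw [hUB] at this
    exact hs' (this ▸ haW))
  have hd : f ∘L P 𝕜 X (V \ W) ∈ D 𝕜 K X := D_mono (fun s hs => hA hs) hA'
  refine ⟨φ ∘L ev 𝕜 X a + f ∘L P 𝕜 X (V \ W), Submodule.add_mem _ (gen_mem a φ) hd, ?_⟩
  have e : f ∘L P 𝕜 X V - (φ ∘L ev 𝕜 X a + f ∘L P 𝕜 X (V \ W))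
      = f ∘L P 𝕜 X W - φ ∘L ev 𝕜 X a := by
    rw [D_split hWV]; abel
  refine lt_of_eq_of_lt (dist_dual _ _) ?_
  rw [e]
  linarith

theorem mem_D [LocallyCompactSpace K] [T2Space K] (hK : Scattered K)
    (f : C₀(K, X) →L[𝕜] 𝕜) : f ∈ D 𝕜 K X := by
  have hcl : IsClosed ((D 𝕜 K X : Submodule 𝕜 _) : Set (C₀(K, X) →L[𝕜] 𝕜)) :=
    Submodule.isClosed_topologicalClosure _
  rw [← SetLike.mem_coe, ← hcl.closure_eq]
  refine (Metric.mem_closure_iff (α := C₀(K, X) →L[𝕜] 𝕜)).2 ?_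
  intro ε hε
  obtain ⟨z, hz, hz'⟩ := f.exists_lt_apply_of_lt_opNorm (r := ‖f‖ - ε / 2) (by linarith)
  set θ : ℝ := (ε / 2) / (‖f‖ + 1) with hθ
  have hfp : 0 < ‖f‖ + 1 := by positivity
  have hθ0 : 0 < θ := by positivity
  have hev : ∀ᶠ t in Filter.cocompact K, ‖z t‖ < θ := by
    have := (zero_at_infty z).norm
    rw [norm_zero] at this
    exact this.eventually_lt_const hθ0
  obtain ⟨s, hs, hs'⟩ := Filter.mem_cocompact.1 hev
  obtain ⟨A, hA, hA'⟩ := D_compact f hs (fun t _ => all_good hK f t)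
  refine ⟨f ∘L P 𝕜 X A, hA', ?_⟩
  have htop : ∀ z : C₀(K, X), P 𝕜 X (⊤ : TopologicalSpace.Clopens K) z = z := fun z => by
    ext t; exact P_mem _ (Set.mem_univ t)
  have hftop : f ∘L P 𝕜 X (⊤ : TopologicalSpace.Clopens K) = f := by
    ext z; simp [htop]
  have hsp := D_split (f := f) (le_top : A ≤ ⊤)
  have hsu := super f A (⊤ \ A) ⊤ le_top le_top (fun t h h' => h'.2 h)
  rw [hftop] at hsp hsu
  have hdist : dist f (f ∘L P 𝕜 X A) = ‖f ∘L P 𝕜 X (⊤ \ A)‖ := by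
    rw [dist_dual]
    congr 1
    rw [sub_eq_iff_eq_add, add_comm]; exact hsp
  rw [hdist]
  have h1 : ‖P 𝕜 X (⊤ \ A) z‖ ≤ θ := by
    refine norm_le_of hθ0.le fun t => ?_
    by_cases h : t ∈ (⊤ \ A : TopologicalSpace.Clopens K)
    · rw [P_mem _ h]
      exact (hs' (fun hts => h.2 (hA hts)) : ‖z t‖ < θ).le
    · rw [P_notMem _ h, norm_zero]; exact hθ0.le
  have h2 : ‖f (P 𝕜 X (⊤ \ A) z)‖ < ε / 2 := by
    refine (f.le_opNorm _).trans_lt ?_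
    calc ‖f‖ * ‖P 𝕜 X (⊤ \ A) z‖ ≤ ‖f‖ * θ := by gcongr
      _ < (‖f‖ + 1) * θ := by nlinarith
      _ = ε / 2 := by rw [hθ]; field_simp
  have h3 : ‖f (P 𝕜 X A z)‖ ≤ ‖f ∘L P 𝕜 X A‖ :=
    (f ∘L P 𝕜 X A).unit_le_opNorm z hz.le
  have h4 : f z = f (P 𝕜 X A z) + f (P 𝕜 X (⊤ \ A) z) := by
    rw [← map_add, ← P_split _ _ le_top, htop]
  have h5 := norm_add_le (f (P 𝕜 X A z)) (f (P 𝕜 X (⊤ \ A) z))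
  rw [← h4] at h5
  linarith

theorem sum_super (f : C₀(K, X) →L[𝕜] 𝕜) (V : K → TopologicalSpace.Clopens K) (s : Finset K)
    (hs : ∀ a ∈ s, ∀ b ∈ s, a ≠ b → ∀ t, t ∈ V a → t ∈ V b → False) :
    ∑ a ∈ s, ‖f ∘L P 𝕜 X (V a)‖ ≤ ‖f ∘L P 𝕜 X (s.sup V)‖ := by
  classical
  induction s using Finset.induction_on with
  | empty => exact ContinuousLinearMap.opNorm_nonneg _
  | insert a s ha ih =>
    rw [Finset.sum_insert ha, Finset.sup_insert]
    have h1 := ih (fun b hb c hc => hs b (Finset.mem_insert_of_mem hb) c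
      (Finset.mem_insert_of_mem hc))
    have h2 := super f (V a) (s.sup V) (V a ⊔ s.sup V) le_sup_left le_sup_right (by
      have hdis : Disjoint (V a) (s.sup V) := by
        rw [Finset.disjoint_sup_right]
        intro b hb
        rw [disjoint_iff_inf_le]
        intro t ht
        exact (hs a (Finset.mem_insert_self _ _) b (Finset.mem_insert_of_mem hb)
          (fun h => ha (h ▸ hb)) t ht.1 ht.2).elim
      intro t h h'
      exact hdis.le_bot (show t ∈ V a ⊓ s.sup V from ⟨h, h'⟩))
    linarith

theorem sum_norm_le [LocallyCompactSpace K] [T2Space K] (hK : Scattered K)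
    (c : K →₀ (X →L[𝕜] 𝕜)) : ∑ t ∈ c.support, ‖c t‖ ≤ ‖T 𝕜 K X c‖ := by
  have := totDisc hK
  obtain ⟨U, hU, hdis⟩ := c.support.finite_toSet.t2_separation
  choose V hVc hV hVU using fun t => exists_clopen (hU t).2 (hU t).1
  have hVd : ∀ a ∈ c.support, ∀ b ∈ c.support, a ≠ b → ∀ t, t ∈ V a → t ∈ V b → False := by
    intro a ha b hb hab t h1 h2
    exact Set.disjoint_left.1 (hdis ha hb hab) (hVU a h1) (hVU b h2)
  have h1 := sum_super (T 𝕜 K X c) V c.support hVd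
  have h2 : ‖T 𝕜 K X c ∘L P 𝕜 X (c.support.sup V)‖ ≤ ‖T 𝕜 K X c‖ := by
    refine ContinuousLinearMap.opNorm_le_bound _ (ContinuousLinearMap.opNorm_nonneg _) fun z => ?_
    refine ((T 𝕜 K X c).le_opNorm _).trans ?_
    gcongr
    exact norm_P_le _ _
  refine le_trans (Finset.sum_le_sum fun t ht => ?_) (h1.trans h2)
  refine ContinuousLinearMap.opNorm_le_bound _ (ContinuousLinearMap.opNorm_nonneg _) fun x => ?_
  have e : (T 𝕜 K X c ∘L P 𝕜 X (V t)) (cst (V t) (hVc t) x) = c t x := by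
    rw [ContinuousLinearMap.comp_apply, T_apply, Finset.sum_eq_single_of_mem t ht]
    · rw [P_mem _ (hV t), cst_mem _ _ (hV t)]
    · intro b hb hbt
      rw [P_notMem _ (fun h => hVd b hb t ht hbt b (hV b) h), map_zero]
  rw [← e]
  refine (ContinuousLinearMap.le_opNorm _ _).trans ?_
  gcongr
  exact norm_cst_le _ _

end

end ScatDual

open ZeroAtInfty in
/-- For `K` scattered locally compact Hausdorff, every norm-one functional on
`C₀(K, X)` is approximated within `ε` by a finite sum `∑ δ_{t_j} ⊗ x*_j` with
`∑ ‖x*_j‖ ≤ 1`. -/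
theorem stmt6 {𝕜 K X : Type*} [RCLike 𝕜] [TopologicalSpace K] [LocallyCompactSpace K]
    [T2Space K] [NormedAddCommGroup X] [NormedSpace 𝕜 X] [CompleteSpace X]
    (hK : Scattered K) (f : C₀(K, X) →L[𝕜] 𝕜) (hf : ‖f‖ = 1)
    (ε : ℝ) (hε : 0 < ε) :
    ∃ (N : ℕ) (t : Fin N → K) (φ : Fin N → (X →L[𝕜] 𝕜)),
      (∑ j, ‖φ j‖) ≤ 1 ∧
      ∃ g : C₀(K, X) →L[𝕜] 𝕜,
        (∀ z : C₀(K, X), g z = ∑ j, φ j (z (t j))) ∧ ‖f - g‖ < ε := by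
  have hmem : f ∈ closure (((ScatDual.T 𝕜 K X).range : Submodule 𝕜 _) :
      Set (C₀(K, X) →L[𝕜] 𝕜)) := ScatDual.mem_D hK f
  obtain ⟨_, ⟨c, rfl⟩, hc⟩ := (Metric.mem_closure_iff (α := C₀(K, X) →L[𝕜] 𝕜)).1 hmem (ε / 2) (by linarith)
  rw [ScatDual.dist_dual] at hc
  set g := ScatDual.T 𝕜 K X c with hg
  have hgn : ‖g‖ ≤ 1 + ε / 2 := by
    have := norm_sub_norm_le g f
    have h' : ‖g - f‖ = ‖f - g‖ := norm_sub_rev (E := C₀(K, X) →L[𝕜] 𝕜) g f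
    rw [h'] at this
    linarith
  have hsum := ScatDual.sum_norm_le hK c
  have hpos : 0 < 1 + ε / 2 := by linarith
  set r : ℝ := (1 + ε / 2)⁻¹ with hr
  have hr0 : 0 < r := inv_pos.2 hpos
  have hr1 : r ≤ 1 := inv_le_one_of_one_le₀ (by linarith)
  have hrm : r * (1 + ε / 2) = 1 := inv_mul_cancel₀ hpos.ne'
  let e := c.support.equivFin
  refine ⟨c.support.card, fun j => (e.symm j : K), fun j => (r : 𝕜) • c (e.symm j), ?_,
    (r : 𝕜) • g, ?_, ?_⟩
  · have h1 : ∑ j, ‖(r : 𝕜) • c (e.symm j : K)‖ = r * ∑ t ∈ c.support, ‖c t‖ := by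
      rw [Equiv.sum_comp e.symm (fun t : c.support => ‖(r : 𝕜) • c (t : K)‖),
        Finset.sum_coe_sort c.support (fun t => ‖(r : 𝕜) • c t‖), Finset.mul_sum]
      refine Finset.sum_congr rfl fun t _ => ?_
      rw [norm_smul, RCLike.norm_ofReal, abs_of_pos hr0]
    rw [h1, ← hrm]
    gcongr
    exact hsum.trans hgn
  · intro z
    have h2 : ∑ j, ((r : 𝕜) • c (e.symm j : K)) (z (e.symm j : K))
        = ∑ t ∈ c.support, ((r : 𝕜) • c t) (z t) := by
      rw [Equiv.sum_comp e.symm (fun t : c.support => ((r : 𝕜) • c (t : K)) (z t)),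
        Finset.sum_coe_sort c.support (fun t => ((r : 𝕜) • c t) (z t))]
    rw [h2, _root_.smul_apply, hg, ScatDual.T_apply, Finset.smul_sum]
    rfl
  · have h3 : f - (r : 𝕜) • g = (f - g) + ((1 - r : ℝ) : 𝕜) • g := by
      ext z
      simp [sub_mul]
    have h4 : ‖((1 - r : ℝ) : 𝕜) • g‖ ≤ ε / 2 := by
      have h5 : ‖((1 - r : ℝ) : 𝕜) • g‖ ≤ (1 - r) * ‖g‖ := by
        refine ContinuousLinearMap.opNorm_le_bound _
          (mul_nonneg (by linarith) (ContinuousLinearMap.opNorm_nonneg _)) fun z => ?_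
        rw [_root_.smul_apply, norm_smul, RCLike.norm_ofReal,
          abs_of_nonneg (by linarith), mul_assoc]
        exact mul_le_mul_of_nonneg_left (g.le_opNorm z) (by linarith)
      refine h5.trans ?_
      calc (1 - r) * ‖g‖ ≤ (1 - r) * (1 + ε / 2) := by
            exact mul_le_mul_of_nonneg_left hgn (by linarith)
        _ = ε / 2 := by linarith
    rw [h3]
    have := norm_add_le (f - g) (((1 - r : ℝ) : 𝕜) • g)
    linarith
end

section
/- Let K be a scattered locally compact Hausdorff space and let X be a Banach space. Let x ∈ B_{C_0(K,X)} and let U be a neighbourhood of x in the relative weak topology of B_{C_0(K,X)}. Then there are a finite subset T of K and an ε > 0 such that every u ∈ B_{C_0(K,X)} satisfying ‖u(t) − x(t)‖ < ε for every t ∈ T belongs to U. -/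
open Metric Topology

section Helpers
open ZeroAtInfty

theorem c0_norm_apply_le {K X : Type*} [TopologicalSpace K] [NormedAddCommGroup X]
    (w : C₀(K, X)) (t : K) : ‖w t‖ ≤ ‖w‖ := by
  rw [← ZeroAtInftyContinuousMap.norm_toBCF_eq_norm]
  exact w.toBCF.norm_coe_le_norm t

theorem c0_norm_le_s7 {K X : Type*} [TopologicalSpace K] [NormedAddCommGroup X]
    (w : C₀(K, X)) {c : ℝ} (hc : 0 ≤ c) (h : ∀ t, ‖w t‖ ≤ c) : ‖w‖ ≤ c := by
  rw [← ZeroAtInftyContinuousMap.norm_toBCF_eq_norm]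
  exact (BoundedContinuousFunction.norm_le hc).2 h

/-- Multiplying by a continuous function with values in `[0,1]`. -/
theorem c0_cut (𝕜 : Type*) {K X : Type*} [RCLike 𝕜] [TopologicalSpace K]
    [NormedAddCommGroup X] [NormedSpace 𝕜 X] (φ : K → ℝ) (hφ : Continuous φ)
    (h0 : ∀ t, 0 ≤ φ t) (h1 : ∀ t, φ t ≤ 1) (w : C₀(K, X)) :
    ∃ g : C₀(K, X), (∀ t, g t = (φ t : 𝕜) • w t) ∧ ‖g‖ ≤ ‖w‖ := by
  have hle : ∀ t, ‖(φ t : 𝕜) • w t‖ ≤ ‖w t‖ := fun t => by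
    rw [norm_smul, RCLike.norm_ofReal, abs_of_nonneg (h0 t)]
    exact mul_le_of_le_one_left (norm_nonneg _) (h1 t)
  refine ⟨⟨⟨fun t => (φ t : 𝕜) • w t, ?_⟩, ?_⟩, fun t => rfl, ?_⟩
  · exact (RCLike.continuous_ofReal.comp hφ).smul w.continuous
  · exact squeeze_zero_norm hle (tendsto_zero_iff_norm_tendsto_zero.1 w.zero_at_infty')
  · exact c0_norm_le_s7 _ (norm_nonneg _) fun t => (hle t).trans (c0_norm_apply_le w t)

/-- Soft threshold. -/
theorem c0_threshold (𝕜 : Type*) {K X : Type*} [RCLike 𝕜] [TopologicalSpace K]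
    [NormedAddCommGroup X] [NormedSpace 𝕜 X] {ε : ℝ} (hε : 0 < ε) (w : C₀(K, X)) :
    ∃ g : C₀(K, X), (∀ t, ‖w t‖ ≤ ε → g t = 0) ∧ ‖g‖ ≤ ‖w‖ ∧ ‖w - g‖ ≤ ε := by
  have hm : ∀ t, 0 < max ‖w t‖ ε := fun t => lt_max_of_lt_right hε
  obtain ⟨g, hg, hgn⟩ := c0_cut 𝕜 (fun t => 1 - ε / max ‖w t‖ ε)
    (continuous_const.sub (continuous_const.div
      (w.continuous.norm.max continuous_const) fun t => (hm t).ne'))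
    (fun t => sub_nonneg.2 ((div_le_one (hm t)).2 (le_max_right _ _)))
    (fun t => sub_le_self _ (div_nonneg hε.le (hm t).le)) w
  refine ⟨g, fun t ht => ?_, hgn, c0_norm_le_s7 _ hε.le fun t => ?_⟩
  · rw [hg, max_eq_right ht, div_self hε.ne']; simp
  · have : (w - g) t = ((ε / max ‖w t‖ ε : ℝ) : 𝕜) • w t := by
      rw [ZeroAtInftyContinuousMap.sub_apply, hg]
      push_cast
      rw [sub_smul, one_smul, sub_sub_cancel]
    rw [this, norm_smul, RCLike.norm_ofReal, abs_of_nonneg (div_nonneg hε.le (hm t).le),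
      div_mul_eq_mul_div, div_le_iff₀ (hm t)]
    exact mul_le_mul_of_nonneg_left (le_max_left _ _) hε.le

/-- Off `A`, the functional is concentrated, up to `η`, on a compact set disjoint from `A`. -/
theorem c0_tight {𝕜 K X : Type*} [RCLike 𝕜] [TopologicalSpace K]
    [NormedAddCommGroup X] [NormedSpace 𝕜 X]
    (f : C₀(K, X) →L[𝕜] 𝕜) (A : Set K) {η : ℝ} (hη : 0 < η) :
    ∃ C : Set K, IsCompact C ∧ Disjoint C A ∧ ∀ v : C₀(K, X), ‖v‖ ≤ 1 →
      (∀ t ∈ A, v t = 0) → (∀ t ∈ C, v t = 0) → ‖f v‖ ≤ η := by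
  set S : Set ℝ := (fun w : C₀(K, X) => ‖f w‖) '' {w | ‖w‖ ≤ 1 ∧ ∀ t ∈ A, w t = 0} with hS
  have hbd : BddAbove S := by
    refine ⟨‖f‖, ?_⟩
    rintro _ ⟨w, ⟨hw, -⟩, rfl⟩
    exact (f.le_opNorm w).trans (mul_le_of_le_one_right (norm_nonneg _) hw)
  have hne : S.Nonempty := ⟨_, 0, ⟨by simp, fun t _ => rfl⟩, rfl⟩
  obtain ⟨_, ⟨w0, ⟨hw0, hw0A⟩, rfl⟩, hlt⟩ := exists_lt_of_lt_csSup hne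
    (show sSup S - η / 2 < sSup S by linarith)
  set ε : ℝ := η / (2 * (‖f‖ + 1)) with hεd
  have hf1 : 0 < ‖f‖ + 1 := by positivity
  have hε : 0 < ε := by positivity
  have hfε : ‖f‖ * ε ≤ η / 2 := by
    have : (‖f‖ + 1) * ε = η / 2 := by rw [hεd]; field_simp
    nlinarith
  obtain ⟨g, hg0, hgn, hgd⟩ := c0_threshold 𝕜 hε w0
  refine ⟨{t | ε ≤ ‖w0 t‖}, ?_, ?_, ?_⟩
  · have hz : ∀ᶠ t in Filter.cocompact K, ‖w0 t‖ < ε :=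
      (tendsto_zero_iff_norm_tendsto_zero.1 w0.zero_at_infty').eventually (gt_mem_nhds hε)
    obtain ⟨D, hD, hDs⟩ := Filter.mem_cocompact.1 hz
    refine hD.of_isClosed_subset (isClosed_le continuous_const w0.continuous.norm) fun t ht => ?_
    by_contra h
    have h1 : ‖w0 t‖ < ε := hDs h
    exact absurd h1 (not_lt.2 ht)
  · rw [Set.disjoint_left]
    intro t ht htA
    have : ε ≤ ‖w0 t‖ := ht
    rw [hw0A t htA, norm_zero] at this
    linarith
  · intro v hv hvA hvC
    obtain ⟨c, hc, hce⟩ := RCLike.exists_norm_eq_mul_self (f g)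
    obtain ⟨d, hd, hde⟩ := RCLike.exists_norm_eq_mul_self (f v)
    have hmem : ‖f (c • g + d • v)‖ ≤ sSup S := by
      refine le_csSup hbd ⟨_, ⟨?_, ?_⟩, rfl⟩
      · refine c0_norm_le_s7 _ zero_le_one fun t => ?_
        rw [ZeroAtInftyContinuousMap.add_apply, ZeroAtInftyContinuousMap.smul_apply,
          ZeroAtInftyContinuousMap.smul_apply]
        rcases le_total ε ‖w0 t‖ with h | h
        · rw [hvC t h, smul_zero, add_zero, norm_smul, hc, one_mul]
          exact (c0_norm_apply_le g t).trans (hgn.trans hw0)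
        · rw [hg0 t h, smul_zero, zero_add, norm_smul, hd, one_mul]
          exact (c0_norm_apply_le v t).trans hv
      · intro t ht
        rw [ZeroAtInftyContinuousMap.add_apply, ZeroAtInftyContinuousMap.smul_apply,
          ZeroAtInftyContinuousMap.smul_apply, hvA t ht,
          hg0 t (by rw [hw0A t ht, norm_zero]; exact hε.le)]
        simp
    have heq : ‖f (c • g + d • v)‖ = ‖f g‖ + ‖f v‖ := by
      rw [map_add, map_smul, map_smul, smul_eq_mul, smul_eq_mul, ← hce, ← hde,
        ← RCLike.ofReal_add, RCLike.norm_ofReal, abs_of_nonneg (by positivity)]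
    have h3 : ‖f w0‖ ≤ ‖f g‖ + η / 2 := by
      have h4 : f w0 = f g + f (w0 - g) := by rw [← map_add]; congr 1; abel
      rw [h4]
      refine (norm_add_le _ _).trans (add_le_add le_rfl ?_)
      exact (f.le_opNorm _).trans ((mul_le_mul_of_nonneg_left hgd (norm_nonneg _)).trans hfε)
    have hlt' : sSup S - η / 2 < ‖f w0‖ := hlt
    linarith

theorem c0_atomic {𝕜 K X : Type*} [RCLike 𝕜] [TopologicalSpace K] [LocallyCompactSpace K]
    [T2Space K] [NormedAddCommGroup X] [NormedSpace 𝕜 X]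
    (hK : Scattered K) (f : C₀(K, X) →L[𝕜] 𝕜) {η : ℝ} (hη : 0 < η) :
    ∃ T : Finset K, ∀ w : C₀(K, X), ‖w‖ ≤ 1 → (∀ t ∈ T, w t = 0) → ‖f w‖ ≤ η := by
  classical
  set P : Set (Set K) := {A | IsClosed A ∧ ∀ η : ℝ, 0 < η → ∃ T : Finset K, ∀ w : C₀(K, X),
    ‖w‖ ≤ 1 → (∀ t ∈ A, w t = 0) → (∀ t ∈ T, w t = 0) → ‖f w‖ ≤ η} with hP
  obtain ⟨A, hA⟩ : ∃ A, Minimal (· ∈ P) A := by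
    refine zorn_superset P fun c hcP hc => ?_
    rcases c.eq_empty_or_nonempty with rfl | hcn
    · refine ⟨Set.univ, ⟨isClosed_univ, fun η hη => ⟨∅, fun w _ hw _ => ?_⟩⟩, by simp⟩
      have : w = 0 := by ext t; exact hw t trivial
      rw [this, map_zero, norm_zero]
      exact hη.le
    refine ⟨⋂₀ c, ⟨isClosed_sInter fun s hs => (hcP hs).1, fun η hη => ?_⟩,
      fun s hs => Set.sInter_subset_of_mem hs⟩
    obtain ⟨C, hC, hCA, hCv⟩ := c0_tight f (⋂₀ c) (half_pos hη)
    obtain ⟨B, hBc, hBC⟩ : ∃ B ∈ c, Disjoint C B := by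
      have : Nonempty c := hcn.to_subtype
      obtain ⟨⟨B, hB⟩, h⟩ := hC.elim_directed_family_closed
        (fun s : c => (s : Set K)) (fun s => (hcP s.2).1)
        (by rw [← Set.sInter_eq_iInter]; exact hCA.inter_eq)
        (by
          intro s s'
          rcases hc.total s.2 s'.2 with h | h
          · exact ⟨s, le_rfl, h⟩
          · exact ⟨s', h, le_rfl⟩)
      exact ⟨B, hB, Set.disjoint_iff_inter_eq_empty.2 h⟩
    obtain ⟨T, hT⟩ := (hcP hBc).2 _ (half_pos hη)
    obtain ⟨φ, hφ0, hφ1, hφ⟩ := exists_continuous_zero_one_of_isCompact hC (hcP hBc).1 hBC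
    refine ⟨T, fun w hw hwA hwT => ?_⟩
    obtain ⟨g, hg, hgn⟩ := c0_cut 𝕜 φ φ.continuous (fun t => (hφ t).1) (fun t => (hφ t).2) w
    obtain ⟨h, hh, hhn⟩ := c0_cut 𝕜 (fun t => 1 - φ t) (continuous_const.sub φ.continuous)
      (fun t => sub_nonneg.2 (hφ t).2) (fun t => sub_le_self _ (hφ t).1) w
    have hsum : w = g + h := by
      ext t
      rw [ZeroAtInftyContinuousMap.add_apply, hg, hh, ← add_smul]
      simp
    have hg' : ‖f g‖ ≤ η / 2 := by
      refine hCv g (hgn.trans hw) (fun t ht => ?_) (fun t ht => ?_)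
      · rw [hg, hwA t ht, smul_zero]
      · rw [hg, hφ0 ht]; simp
    have hh' : ‖f h‖ ≤ η / 2 := by
      refine hT h (hhn.trans hw) (fun t ht => ?_) (fun t ht => ?_)
      · rw [hh, hφ1 ht]; simp
      · rw [hh, hwT t ht, smul_zero]
    rw [hsum, map_add]
    linarith [norm_add_le (f g) (f h)]
  rcases A.eq_empty_or_nonempty with rfl | hne
  · obtain ⟨T, hT⟩ := hA.prop.2 η hη
    exact ⟨T, fun w hw h => hT w hw (by simp) h⟩
  · exfalso
    obtain ⟨a, ha, V, hV, hVa⟩ := hK A hne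
    have hmem : A \ V ∈ P := by
      refine ⟨hA.prop.1.sdiff hV, fun η hη => ?_⟩
      obtain ⟨T, hT⟩ := hA.prop.2 η hη
      refine ⟨insert a T, fun w hw hwA hwT => hT w hw (fun t ht => ?_)
        fun t ht => hwT t (Finset.mem_insert_of_mem ht)⟩
      by_cases htV : t ∈ V
      · have : t ∈ V ∩ A := ⟨htV, ht⟩
        rw [hVa] at this
        exact hwT t (by rw [this]; exact Finset.mem_insert_self _ _)
      · exact hwA t ⟨ht, htV⟩
    have haV : a ∈ V ∩ A := by rw [hVa]; rfl
    exact (hA.le_of_le hmem Set.sdiff_subset ha).2 haV.1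

theorem c0_functional {𝕜 K X : Type*} [RCLike 𝕜] [TopologicalSpace K] [LocallyCompactSpace K]
    [T2Space K] [NormedAddCommGroup X] [NormedSpace 𝕜 X]
    (hK : Scattered K) (f : C₀(K, X) →L[𝕜] 𝕜) (x : C₀(K, X)) (hx : ‖x‖ ≤ 1)
    {δ : ℝ} (hδ : 0 < δ) :
    ∃ (T : Finset K) (ε : ℝ), 0 < ε ∧
      ∀ u : C₀(K, X), ‖u‖ ≤ 1 → (∀ t ∈ T, ‖u t - x t‖ < ε) → ‖f u - f x‖ < δ := by
  obtain ⟨T, hT⟩ := c0_atomic hK f (show 0 < δ / 8 by positivity)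
  have hf1 : 0 < ‖f‖ + 1 := by positivity
  refine ⟨T, δ / (2 * (‖f‖ + 1)), by positivity, fun u hu hut => ?_⟩
  set ε : ℝ := δ / (2 * (‖f‖ + 1)) with hεd
  have hε : 0 < ε := by positivity
  have hfε : ‖f‖ * ε ≤ δ / 2 := by
    have : (‖f‖ + 1) * ε = δ / 2 := by rw [hεd]; field_simp
    nlinarith
  obtain ⟨g, hg0, hgn, hgd⟩ := c0_threshold 𝕜 hε (u - x)
  have hg2 : ‖g‖ ≤ 2 := hgn.trans ((norm_sub_le u x).trans (by linarith))
  have h1 : ‖f ((2⁻¹ : 𝕜) • g)‖ ≤ δ / 8 := by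
    refine hT _ ?_ fun t ht => ?_
    · rw [norm_smul, norm_inv, RCLike.norm_ofNat]; linarith
    · rw [ZeroAtInftyContinuousMap.smul_apply, hg0 t (hut t ht).le, smul_zero]
  rw [map_smul, norm_smul, norm_inv, RCLike.norm_ofNat] at h1
  have h2 : f u - f x = f g + f (u - x - g) := by
    rw [← map_sub, ← map_add]; congr 1; abel
  have h3 : ‖f (u - x - g)‖ ≤ δ / 2 :=
    (f.le_opNorm _).trans ((mul_le_mul_of_nonneg_left hgd (norm_nonneg _)).trans hfε)
  rw [h2]
  linarith [norm_add_le (f g) (f (u - x - g))]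

end Helpers

open ZeroAtInfty in
/-- For `K` scattered locally compact Hausdorff, every relative-weak
neighbourhood of `x` in `B_{C₀(K,X)}` contains all `u ∈ B_{C₀(K,X)}` which are uniformly
close to `x` on some finite set `T ⊆ K`. -/
theorem stmt7 {𝕜 K X : Type*} [RCLike 𝕜] [TopologicalSpace K] [LocallyCompactSpace K]
    [T2Space K] [NormedAddCommGroup X] [NormedSpace 𝕜 X] [CompleteSpace X]
    (hK : Scattered K) (x : C₀(K, X)) (hx : ‖x‖ ≤ 1)
    (U : Set C₀(K, X)) (hU : RelWeakInterior 𝕜 U x) :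
    ∃ (T : Finset K) (ε : ℝ), 0 < ε ∧
      ∀ u : C₀(K, X), ‖u‖ ≤ 1 → (∀ t ∈ T, ‖u t - x t‖ < ε) → u ∈ U := by
  classical
  obtain ⟨V, hV, hxV, hVU⟩ := hU
  obtain ⟨W, hW, rfl⟩ := isOpen_induced_iff.1 hV
  obtain ⟨I, O, hO, hsubset⟩ := isOpen_pi_iff.1 hW _ hxV
  have key : ∀ J : Finset (C₀(K, X) →L[𝕜] 𝕜), J ⊆ I → ∃ (T : Finset K) (ε : ℝ), 0 < ε ∧
      ∀ u : C₀(K, X), ‖u‖ ≤ 1 → (∀ t ∈ T, ‖u t - x t‖ < ε) → ∀ f ∈ J, f u ∈ O f := by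
    intro J
    induction J using Finset.induction_on with
    | empty => exact fun _ => ⟨∅, 1, one_pos, by simp⟩
    | insert f J hf ih =>
      intro hJ
      obtain ⟨T, ε, hε, h⟩ := ih ((Finset.subset_insert _ _).trans hJ)
      obtain ⟨hOo, hxO⟩ := hO f (hJ (Finset.mem_insert_self _ _))
      obtain ⟨δ, hδ, hball⟩ := Metric.isOpen_iff.1 hOo _ hxO
      obtain ⟨T', ε', hε', h'⟩ := c0_functional hK f x hx hδ
      refine ⟨T ∪ T', min ε ε', lt_min hε hε', fun u hu hut g hg => ?_⟩
      rcases Finset.mem_insert.1 hg with rfl | hg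
      · refine hball (mem_ball_iff_norm.2 (h' u hu fun t ht => ?_))
        exact (hut t (Finset.mem_union_right _ ht)).trans_le (min_le_right _ _)
      · refine h u hu (fun t ht => ?_) g hg
        exact (hut t (Finset.mem_union_left _ ht)).trans_le (min_le_left _ _)
  obtain ⟨T, ε, hε, h⟩ := key I subset_rfl
  refine ⟨T, ε, hε, fun u hu hut => hVU ⟨hsubset fun f hf => h u hu hut f hf, ?_⟩⟩
  exact mem_closedBall_zero_iff.2 hu
end
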